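/- Let u : ℝ × [0,∞) → ℝ be a smooth function, 2π-periodic in its first variable, with u(θ,t) > 0 everywhere, satisfying the normalized affine flow ∂_t u = (1/4)(κ − κ̄)·u with κ(θ,t) = u³·(∂²_θ u + u), κ̄(t) = (∫_0^{2π} κ u^{−2} dθ)/(∫_0^{2π} u^{−2} dθ), ∫_0^{2π} u(θ,0)^{−2} dθ = 2π, and satisfying the orthogonality condition ∫_0^{2π} u(θ,0)^{−3} cos θ dθ = ∫_0^{2π} u(θ,0)^{−3} sin θ dθ = 0. Then sup_{θ∈ℝ} |κ(θ,t) − κ̄(t)| → 0 as t → +∞. -/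

import Mathlib

open Real MeasureTheory Filter Topology

/-- Wirtinger's inequality on `[0, 2π]`. -/
theorem wirtinger_inequality {w w' : ℝ → ℝ} (hw : ∀ x, HasDerivAt w (w' x) x)
    (hw' : Continuous w') (hper : w (2 * π) = w 0) (hmean : ∫ x in (0:ℝ)..2 * π, w x = 0) :
    ∫ x in (0:ℝ)..2 * π, w x ^ 2 ≤ ∫ x in (0:ℝ)..2 * π, w' x ^ 2 := by
  have hab : (0:ℝ) < 2 * π := by positivity
  have hwc : Continuous w := continuous_iff_continuousAt.2 fun x => (hw x).continuousAt
  have parseval : ∀ f : ℝ → ℝ, Continuous f →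
      HasSum (fun i => ‖fourierCoeffOn hab (fun x => (f x : ℂ)) i‖ ^ 2)
        ((2 * π)⁻¹ * ∫ x in (0:ℝ)..2 * π, f x ^ 2) := by
    intro f hf
    have hL2 : MemLp (fun x => (f x : ℂ)) 2 (volume.restrict (Set.Ioc 0 (2 * π))) := by
      have hc : Continuous fun x => (f x : ℂ) := Complex.continuous_ofReal.comp hf
      obtain ⟨C, hC⟩ := (isCompact_Icc (a := (0:ℝ)) (b := 2 * π)).exists_bound_of_continuousOn
        hc.continuousOn
      refine MemLp.of_bound hc.aestronglyMeasurable C ?_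
      refine (ae_restrict_iff' measurableSet_Ioc).2 (.of_forall fun x hx => hC x ⟨hx.1.le, hx.2⟩)
    simpa using hasSum_sq_fourierCoeffOn hab hL2
  have hle := hasSum_le (fun i => ?_) (parseval w hwc) (parseval w' hw')
  · exact le_of_mul_le_mul_left hle (by positivity)
  by_cases hi : i = 0
  · have : fourierCoeffOn hab (fun x => (w x : ℂ)) i = 0 := by
      rw [fourierCoeffOn_eq_integral, hi]
      simp [intervalIntegral.integral_ofReal, hmean]
    rw [this]
    simp
  · have hder : ∀ x ∈ Set.uIcc 0 (2 * π), HasDerivAt (fun x => (w x : ℂ)) (w' x : ℂ) x :=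
      fun x _ => (hw x).ofReal_comp
    have hint : IntervalIntegrable (fun x => (w' x : ℂ)) volume 0 (2 * π) :=
      (Complex.continuous_ofReal.comp hw').intervalIntegrable _ _
    rw [fourierCoeffOn_of_hasDerivAt hab hi hder hint]
    have h1 : (1:ℝ) ≤ |(i:ℝ)| := by
      rw [← Int.cast_abs]
      exact_mod_cast Int.one_le_abs hi
    have hpi := Real.pi_pos
    gcongr
    rw [hper]
    simp only [sub_self, mul_zero, zero_sub, norm_mul, norm_neg, norm_div, Complex.norm_real,
      Complex.norm_I, norm_one, Complex.norm_intCast, Complex.norm_ofNat, mul_one, sub_zero,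
      Complex.ofReal_zero, Complex.ofReal_mul, Complex.ofReal_ofNat, Real.norm_eq_abs, abs_of_pos hpi]
    rw [← mul_assoc]
    refine mul_le_of_le_one_left (norm_nonneg _) ?_
    rw [div_mul_eq_mul_div, one_mul, div_le_one (by positivity)]
    exact le_mul_of_one_le_right (by positivity) h1

theorem integral_mul_sin_sub {f : ℝ → ℝ} (hf : Continuous f) (a b β : ℝ) :
    ∫ s in a..b, f s * sin (β - s) =
      sin β * (∫ s in a..b, f s * cos s) - cos β * ∫ s in a..b, f s * sin s := by
  rw [← intervalIntegral.integral_const_mul, ← intervalIntegral.integral_const_mul,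
    ← intervalIntegral.integral_sub]
  · congr 1; ext s; rw [sin_sub]; ring
  · exact (by fun_prop : Continuous _).intervalIntegrable _ _
  · exact (by fun_prop : Continuous _).intervalIntegrable _ _

theorem hasDerivAt_integral_right {f : ℝ → ℝ} (hf : Continuous f) (a x : ℝ) :
    HasDerivAt (fun x => ∫ s in a..x, f s) (f x) x :=
  intervalIntegral.integral_hasDerivAt_right (hf.intervalIntegrable _ _)
    (hf.stronglyMeasurableAtFilter _ _) hf.continuousAt

/-- The arithmetic-geometric mean step `27 (J b)² f² ≤ 4 (b² + J f)³`, in terms of cube roots. -/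
theorem amgm_cube_root {J b f g y : ℝ} (hJ : 0 < J) (hb : 0 < b) (hf : 0 < f)
    (hgf : g ^ 3 = f ^ 2) (hy3 : y ^ 3 = 4 * (J * b)) :
    g * (3 * y ^ 2) ≤ 4 * (b ^ 2 + J * f) := by
  have h : (g * (3 * y ^ 2)) ^ 3 ≤ (4 * (b ^ 2 + J * f)) ^ 3 := by
    have e : (g * (3 * y ^ 2)) ^ 3 = 27 * (f ^ 2 * (4 * (J * b)) ^ 2) := by
      rw [← hy3, ← hgf]; ring
    rw [e]
    have hX : 0 < b ^ 2 := by positivity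
    have hY : 0 < J * f := by positivity
    have : 27 * (f ^ 2 * (4 * (J * b)) ^ 2) = 432 * (b ^ 2 * (J * f) ^ 2) := by ring
    rw [this]
    generalize b ^ 2 = X at *
    generalize J * f = Y at *
    nlinarith [mul_nonneg (add_pos hX hY).le (sq_nonneg (2 * X - Y)), mul_nonneg hX.le (sq_nonneg (2 * X - Y)), mul_nonneg hY.le (sq_nonneg (2 * X - Y))]
  exact le_of_pow_le_pow_left₀ (by norm_num) (by positivity) h

/-- The affine length of a convex arc is controlled by the area of its tangent triangle. -/
theorem affine_length_cube_le_triangle {f g : ℝ → ℝ} (hf : Continuous f) (hg : Continuous g)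
    (hfpos : ∀ x, 0 < f x) (hgpos : ∀ x, 0 < g x) (hgf : ∀ x, g x ^ 3 = f x ^ 2)
    {γ : ℝ} (hγ : 0 < γ) (hγπ : γ < π) :
    (∫ s in (0:ℝ)..γ, g s) ^ 3 ≤
      4 * ((∫ s in (0:ℝ)..γ, f s * sin (γ - s)) * ((∫ s in (0:ℝ)..γ, f s * sin s) / sin γ)) := by
  set S : ℝ → ℝ := fun β => ∫ s in (0:ℝ)..β, f s * sin s with hS
  set C : ℝ → ℝ := fun β => ∫ s in (0:ℝ)..β, f s * cos s with hC
  set J : ℝ → ℝ := fun β => sin β * C β - cos β * S β with hJ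
  set W : ℝ → ℝ := fun β => ∫ s in (0:ℝ)..β, g s with hW
  have hJeq : ∀ β, ∫ s in (0:ℝ)..β, f s * sin (β - s) = J β := fun β =>
    integral_mul_sin_sub hf 0 β β
  rw [hJeq]
  have dS : ∀ β, HasDerivAt S (f β * sin β) β := fun β =>
    hasDerivAt_integral_right (f := fun s => f s * sin s) (by fun_prop) 0 β
  have dC : ∀ β, HasDerivAt C (f β * cos β) β := fun β =>
    hasDerivAt_integral_right (f := fun s => f s * cos s) (by fun_prop) 0 β
  have dW : ∀ β, HasDerivAt W (g β) β := fun β => hasDerivAt_integral_right hg 0 β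
  have dJ : ∀ β, HasDerivAt J (cos β * C β + sin β * S β) β := fun β => by
    refine HasDerivAt.congr_deriv (f := J)
      (((hasDerivAt_sin β).mul (dC β)).sub ((hasDerivAt_cos β).mul (dS β))) ?_
    ring
  have sinpos : ∀ β, 0 < β → β ≤ γ → 0 < sin β := fun β h1 h2 =>
    sin_pos_of_pos_of_lt_pi h1 (h2.trans_lt hγπ)
  have Spos : ∀ β, 0 < β → β ≤ γ → 0 < S β := fun β h1 h2 => by
    refine intervalIntegral.intervalIntegral_pos_of_pos_on
      ((by fun_prop : Continuous fun s => f s * sin s).intervalIntegrable _ _) (fun x hx => ?_) h1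
    exact mul_pos (hfpos x) (sinpos x hx.1 (hx.2.le.trans h2))
  have Jpos : ∀ β, 0 < β → β ≤ γ → 0 < J β := fun β h1 h2 => by
    rw [← hJeq]
    refine intervalIntegral.intervalIntegral_pos_of_pos_on
      ((by fun_prop : Continuous fun s => f s * sin (β - s)).intervalIntegrable _ _)
      (fun x hx => ?_) h1
    exact mul_pos (hfpos x) (sinpos _ (by linarith [hx.2]) (by linarith [hx.1]))
  set U : ℝ → ℝ := fun β => 4 * (J β * (S β / sin β)) with hU
  have Upos : ∀ β, 0 < β → β ≤ γ → 0 < U β := fun β h1 h2 => by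
    have := Jpos β h1 h2; have := Spos β h1 h2; have := sinpos β h1 h2
    positivity
  have dU : ∀ β, 0 < β → β ≤ γ → HasDerivAt U (4 * ((S β / sin β) ^ 2 + J β * f β)) β := by
    intro β h1 h2
    have hs := (sinpos β h1 h2).ne'
    refine HasDerivAt.congr_deriv (f := U)
      (((dJ β).mul ((dS β).div (hasDerivAt_sin β) hs)).const_mul 4) ?_
    have hJβ : J β = sin β * C β - cos β * S β := rfl
    rw [Pi.div_apply]
    field_simp
    rw [hJβ]
    linear_combination S β ^ 2 * sin_sq_add_cos_sq β
  have key : ∀ ε, 0 < ε → ε ≤ γ → W γ - W ε ≤ U γ ^ (1 / 3 : ℝ) := by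
    intro ε h1 h2
    have dy : ∀ β, 0 < β → β ≤ γ → HasDerivAt (fun β => U β ^ (1 / 3 : ℝ) - W β)
        (4 * ((S β / sin β) ^ 2 + J β * f β) * (1 / 3) * U β ^ (1 / 3 - 1 : ℝ) - g β) β :=
      fun β h1 h2 => ((dU β h1 h2).rpow_const (Or.inl (Upos β h1 h2).ne')).sub (dW β)
    have hmono : MonotoneOn (fun β => U β ^ (1 / 3 : ℝ) - W β) (Set.Icc ε γ) := by
      refine monotoneOn_of_hasDerivWithinAt_nonneg (convex_Icc _ _)
        (fun x hx => (dy x (by linarith [hx.1]) hx.2).continuousAt.continuousWithinAt)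
        (fun x hx => (dy x ?_ ?_).hasDerivWithinAt) (fun x hx => ?_)
      · rw [interior_Icc] at hx; linarith [hx.1]
      · rw [interior_Icc] at hx; exact hx.2.le
      · rw [interior_Icc] at hx
        have hx0 : 0 < x := by linarith [hx.1]
        have hu := Upos x hx0 hx.2.le
        have hJ' := Jpos x hx0 hx.2.le
        have hb : 0 < S x / sin x := div_pos (Spos x hx0 hx.2.le) (sinpos x hx0 hx.2.le)
        set y := U x ^ (1 / 3 : ℝ) with hy
        have hypos : 0 < y := by positivity
        have hy3 : y ^ 3 = U x := by
          rw [hy, ← rpow_natCast, ← rpow_mul hu.le]; norm_num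
        have hyn : U x ^ (1 / 3 - 1 : ℝ) = (y ^ 2)⁻¹ := by
          rw [hy, ← rpow_natCast, ← rpow_mul hu.le, ← rpow_neg hu.le]; norm_num
        rw [hyn, sub_nonneg, ← div_eq_mul_inv, le_div_iff₀ (by positivity)]
        have := amgm_cube_root hJ' hb (hfpos x) (hgf x) hy3
        linarith
    have := hmono ⟨le_rfl, h2⟩ ⟨h2, le_rfl⟩ h2
    have hp : 0 < U ε ^ (1 / 3 : ℝ) := rpow_pos_of_pos (Upos ε h1 h2) _
    simp only at this
    linarith
  have hlim : W γ ≤ U γ ^ (1 / 3 : ℝ) := by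
    have ht : Tendsto (fun ε => W γ - W ε) (𝓝[>] 0) (𝓝 (W γ - W 0)) :=
      ((dW 0).continuousAt.tendsto.mono_left nhdsWithin_le_nhds).const_sub _
    have hW0 : W 0 = 0 := by simp [hW]
    rw [hW0, sub_zero] at ht
    refine le_of_tendsto ht ?_
    filter_upwards [Ioc_mem_nhdsGT hγ] with ε hε using key ε hε.1 hε.2
  have hW0 : 0 ≤ W γ := intervalIntegral.integral_nonneg hγ.le fun x _ => (hgpos x).le
  calc W γ ^ 3 ≤ (U γ ^ (1 / 3 : ℝ)) ^ 3 := by gcongr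
    _ = U γ := by
      rw [← rpow_natCast, ← rpow_mul (Upos γ hγ le_rfl).le]; norm_num

/-- Weak affine isoperimetric inequality for an arc of total turning `π`. -/
theorem affine_length_cube_le_half {f g : ℝ → ℝ} (hf : Continuous f) (hg : Continuous g)
    (hfpos : ∀ x, 0 < f x) (hgpos : ∀ x, 0 < g x) (hgf : ∀ x, g x ^ 3 = f x ^ 2) :
    (∫ s in (0:ℝ)..π, g s) ^ 3 ≤
      16 * ∫ x in (0:ℝ)..π, (∫ s in (0:ℝ)..x, f s * sin (x - s)) * f x := by
  have ii : ∀ {h : ℝ → ℝ} (_ : Continuous h) (a b : ℝ), IntervalIntegrable h volume a b :=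
    fun h a b => h.intervalIntegrable a b
  have cs : Continuous fun s => f s * sin s := by fun_prop
  have cc : Continuous fun s => f s * cos s := by fun_prop
  obtain ⟨γ, hγ, hγ0⟩ : ∃ γ ∈ Set.Ioo (0:ℝ) π, ∫ s in (0:ℝ)..π, f s * sin (γ - s) = 0 := by
    have hpos : 0 < ∫ s in (0:ℝ)..π, f s * sin s :=
      intervalIntegral.intervalIntegral_pos_of_pos_on (ii cs _ _)
        (fun x hx => mul_pos (hfpos x) (sin_pos_of_mem_Ioo hx)) pi_pos
    have hcont : ContinuousOn (fun γ => ∫ s in (0:ℝ)..π, f s * sin (γ - s)) (Set.Icc 0 π) := by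
      simp_rw [integral_mul_sin_sub hf]
      fun_prop
    refine intermediate_value_Ioo pi_pos.le hcont ⟨?_, ?_⟩
    · simp only [integral_mul_sin_sub hf]; simp [hpos]
    · simp only [integral_mul_sin_sub hf]; simp [hpos]
  have hs : 0 < sin γ := sin_pos_of_mem_Ioo hγ
  have hJ2 : ∫ s in γ..π, f s * sin (s - γ) = ∫ s in (0:ℝ)..γ, f s * sin (γ - s) := by
    have := intervalIntegral.integral_add_adjacent_intervals
      (ii (by fun_prop : Continuous fun s => f s * sin (γ - s)) 0 γ)
      (ii (by fun_prop : Continuous fun s => f s * sin (γ - s)) γ π)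
    have h2 : ∫ s in γ..π, f s * sin (s - γ) = - ∫ s in γ..π, f s * sin (γ - s) := by
      rw [← intervalIntegral.integral_neg]
      congr 1; ext s
      rw [← neg_sub γ s, sin_neg]; ring
    linarith
  have h1 := affine_length_cube_le_triangle hf hg hfpos hgpos hgf hγ.1 hγ.2
  have h2 := affine_length_cube_le_triangle (f := fun s => f (π - s)) (g := fun s => g (π - s))
    (by fun_prop) (by fun_prop) (fun _ => hfpos _) (fun _ => hgpos _) (fun _ => hgf _)
    (γ := π - γ) (by linarith [hγ.2]) (by linarith [hγ.1])
  have e1 : ∫ s in (0:ℝ)..(π - γ), g (π - s) = ∫ s in γ..π, g s := by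
    rw [intervalIntegral.integral_comp_sub_left (fun s => g s)]; simp
  have e2 : ∫ s in (0:ℝ)..(π - γ), f (π - s) * sin (π - γ - s) =
      ∫ s in γ..π, f s * sin (s - γ) := by
    have := intervalIntegral.integral_comp_sub_left (a := 0) (b := π - γ)
      (fun s => f s * sin (s - γ)) π
    simp only [sub_sub_cancel, sub_zero] at this
    rw [← this]
    congr 1; ext s; ring_nf
  have e3 : ∫ s in (0:ℝ)..(π - γ), f (π - s) * sin s = ∫ s in γ..π, f s * sin s := by
    have := intervalIntegral.integral_comp_sub_left (a := 0) (b := π - γ)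
      (fun s => f s * sin s) π
    simp only [sub_sub_cancel, sub_zero, sin_pi_sub] at this
    exact this
  rw [e1, e2, e3, hJ2, sin_pi_sub] at h2
  set A := ∫ s in (0:ℝ)..γ, g s
  set B := ∫ s in γ..π, g s
  have hA : 0 ≤ A := intervalIntegral.integral_nonneg hγ.1.le fun x _ => (hgpos x).le
  have hB : 0 ≤ B := intervalIntegral.integral_nonneg hγ.2.le fun x _ => (hgpos x).le
  have hAB : ∫ s in (0:ℝ)..π, g s = A + B :=
    (intervalIntegral.integral_add_adjacent_intervals (ii hg _ _) (ii hg _ _)).symm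
  have hSsum := intervalIntegral.integral_add_adjacent_intervals (ii cs 0 γ) (ii cs γ π)
  have hCsum := intervalIntegral.integral_add_adjacent_intervals (ii cc 0 γ) (ii cc γ π)
  have hJγ := integral_mul_sin_sub hf 0 γ γ
  rw [integral_mul_sin_sub hf] at hγ0
  set Jγ := ∫ s in (0:ℝ)..γ, f s * sin (γ - s)
  set Sγ := ∫ s in (0:ℝ)..γ, f s * sin s
  set Cγ := ∫ s in (0:ℝ)..γ, f s * cos s
  set S1 := ∫ s in γ..π, f s * sin s
  set C1 := ∫ s in γ..π, f s * cos s
  rw [← hSsum, ← hCsum] at hγ0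
  have cJ : Continuous fun x => ∫ s in (0:ℝ)..x, f s * sin (x - s) := by
    simp_rw [integral_mul_sin_sub hf]
    have a1 : Continuous fun x => ∫ s in (0:ℝ)..x, f s * cos s :=
      intervalIntegral.continuous_primitive (fun a b => ii cc a b) 0
    have a2 : Continuous fun x => ∫ s in (0:ℝ)..x, f s * sin s :=
      intervalIntegral.continuous_primitive (fun a b => ii cs a b) 0
    fun_prop
  have hI : Jγ * (Sγ / sin γ) + Jγ * (S1 / sin γ) ≤
      ∫ x in (0:ℝ)..π, (∫ s in (0:ℝ)..x, f s * sin (x - s)) * f x := by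
    rw [← intervalIntegral.integral_add_adjacent_intervals (b := γ) (ii (by fun_prop) _ _)
      (ii (by fun_prop) _ _)]
    have p1 : 0 ≤ ∫ x in (0:ℝ)..γ, (∫ s in (0:ℝ)..x, f s * sin (x - s)) * f x := by
      refine intervalIntegral.integral_nonneg hγ.1.le fun x hx => mul_nonneg ?_ (hfpos x).le
      refine intervalIntegral.integral_nonneg hx.1 fun s hs => mul_nonneg (hfpos s).le ?_
      exact sin_nonneg_of_nonneg_of_le_pi (by linarith [hs.2]) (by linarith [hs.1, hx.2, hγ.2])
    have p2 : ∫ x in γ..π, (sin x * Cγ - cos x * Sγ) * f x ≤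
        ∫ x in γ..π, (∫ s in (0:ℝ)..x, f s * sin (x - s)) * f x := by
      refine intervalIntegral.integral_mono_on hγ.2.le (ii (by fun_prop) _ _)
        (ii (by fun_prop) _ _) fun x hx => mul_le_mul_of_nonneg_right ?_ (hfpos x).le
      have := intervalIntegral.integral_add_adjacent_intervals
        (ii (by fun_prop : Continuous fun s => f s * sin (x - s)) 0 γ)
        (ii (by fun_prop : Continuous fun s => f s * sin (x - s)) γ x)
      rw [← this, integral_mul_sin_sub hf 0 γ]
      refine le_add_of_nonneg_right ?_
      refine intervalIntegral.integral_nonneg hx.1 fun s hs => mul_nonneg (hfpos s).le ?_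
      exact sin_nonneg_of_nonneg_of_le_pi (by linarith [hs.2]) (by linarith [hs.1, hx.2, hγ.1])
    have p3 : ∫ x in γ..π, (sin x * Cγ - cos x * Sγ) * f x = Cγ * S1 - Sγ * C1 := by
      rw [← intervalIntegral.integral_const_mul, ← intervalIntegral.integral_const_mul,
        ← intervalIntegral.integral_sub (ii (by fun_prop) _ _) (ii (by fun_prop) _ _)]
      congr 1; ext x; ring
    have p4 : Jγ * (Sγ / sin γ) + Jγ * (S1 / sin γ) = Cγ * S1 - Sγ * C1 := by
      rw [hJγ]
      field_simp
      linear_combination Sγ * hγ0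
    linarith
  have hcube : (A + B) ^ 3 ≤ 4 * (A ^ 3 + B ^ 3) := by
    nlinarith [mul_nonneg (add_nonneg hA hB) (sq_nonneg (A - B))]
  rw [hAB]
  linarith

/-- Weak affine isoperimetric inequality for a closed convex curve with radius of curvature `f`. -/
theorem affine_length_cube_le_area {f g : ℝ → ℝ} (hf : Continuous f) (hg : Continuous g)
    (hfpos : ∀ x, 0 < f x) (hgpos : ∀ x, 0 < g x) (hgf : ∀ x, g x ^ 3 = f x ^ 2)
    (hcos : ∫ s in (0:ℝ)..2 * π, f s * cos s = 0) (hsin : ∫ s in (0:ℝ)..2 * π, f s * sin s = 0) :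
    (∫ s in (0:ℝ)..2 * π, g s) ^ 3 ≤
      64 * ∫ x in (0:ℝ)..2 * π, (∫ s in (0:ℝ)..x, f s * sin (x - s)) * f x := by
  have ii : ∀ {h : ℝ → ℝ} (_ : Continuous h) (a b : ℝ), IntervalIntegrable h volume a b :=
    fun h a b => h.intervalIntegrable a b
  have cs : Continuous fun s => f s * sin s := by fun_prop
  have cc : Continuous fun s => f s * cos s := by fun_prop
  have hpi := pi_pos
  have cJ : ∀ a, Continuous fun x => ∫ s in a..x, f s * sin (x - s) := by
    intro a
    simp_rw [integral_mul_sin_sub hf]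
    have a1 : Continuous fun x => ∫ s in a..x, f s * cos s :=
      intervalIntegral.continuous_primitive (fun a b => ii cc a b) a
    have a2 : Continuous fun x => ∫ s in a..x, f s * sin s :=
      intervalIntegral.continuous_primitive (fun a b => ii cs a b) a
    fun_prop
  have cJ0 := cJ 0
  have cJπ := cJ π
  have h1 := affine_length_cube_le_half hf hg hfpos hgpos hgf
  have h2 := affine_length_cube_le_half (f := fun s => f (s + π)) (g := fun s => g (s + π))
    (by fun_prop) (by fun_prop) (fun _ => hfpos _) (fun _ => hgpos _) (fun _ => hgf _)
  have e1 : ∫ s in (0:ℝ)..π, g (s + π) = ∫ s in π..2 * π, g s := by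
    rw [intervalIntegral.integral_comp_add_right (fun s => g s)]; congr 1 <;> ring
  have e2 : ∀ x, ∫ s in (0:ℝ)..x, f (s + π) * sin (x - s) =
      ∫ s in π..(x + π), f s * sin (x + π - s) := by
    intro x
    have := intervalIntegral.integral_comp_add_right (a := 0) (b := x)
      (fun s => f s * sin (x + π - s)) π
    simp only [zero_add] at this
    rw [← this]
    congr 1; ext s; ring_nf
  have e3 : ∫ x in (0:ℝ)..π, (∫ s in (0:ℝ)..x, f (s + π) * sin (x - s)) * f (x + π) =
      ∫ x in π..2 * π, (∫ s in π..x, f s * sin (x - s)) * f x := by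
    simp_rw [e2]
    rw [intervalIntegral.integral_comp_add_right
      (fun x => (∫ s in π..x, f s * sin (x - s)) * f x)]
    congr 1 <;> ring
  rw [e1, e3] at h2
  have e4 : ∫ x in π..2 * π, (∫ s in (0:ℝ)..x, f s * sin (x - s)) * f x =
      ∫ x in π..2 * π, (∫ s in π..x, f s * sin (x - s)) * f x := by
    have hSsum := intervalIntegral.integral_add_adjacent_intervals (ii cs 0 π) (ii cs π (2 * π))
    have hCsum := intervalIntegral.integral_add_adjacent_intervals (ii cc 0 π) (ii cc π (2 * π))
    rw [hsin] at hSsum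
    rw [hcos] at hCsum
    have p : ∀ x, (∫ s in (0:ℝ)..x, f s * sin (x - s)) * f x =
        ((∫ s in (0:ℝ)..π, f s * cos s) * (f x * sin x) -
          (∫ s in (0:ℝ)..π, f s * sin s) * (f x * cos x)) +
          (∫ s in π..x, f s * sin (x - s)) * f x := by
      intro x
      have := intervalIntegral.integral_add_adjacent_intervals
        (ii (by fun_prop : Continuous fun s => f s * sin (x - s)) 0 π)
        (ii (by fun_prop : Continuous fun s => f s * sin (x - s)) π x)
      rw [← this, integral_mul_sin_sub hf 0 π]
      ring
    simp_rw [p]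
    rw [intervalIntegral.integral_add (ii (by fun_prop) _ _) (ii (by fun_prop) _ _),
      intervalIntegral.integral_sub (ii (by fun_prop) _ _) (ii (by fun_prop) _ _),
      intervalIntegral.integral_const_mul, intervalIntegral.integral_const_mul,
      eq_neg_of_add_eq_zero_left hSsum, eq_neg_of_add_eq_zero_left hCsum]
    ring
  have hsplit := intervalIntegral.integral_add_adjacent_intervals
    (ii (cJ0.mul hf) 0 π) (ii (cJ0.mul hf) π (2 * π))
  simp only [Pi.mul_apply] at hsplit
  rw [← hsplit, e4,
    ← intervalIntegral.integral_add_adjacent_intervals (b := π) (ii hg _ _) (ii hg _ _)]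
  set A := ∫ s in (0:ℝ)..π, g s
  set B := ∫ s in π..2 * π, g s
  have hA : 0 ≤ A := intervalIntegral.integral_nonneg hpi.le fun x _ => (hgpos x).le
  have hB : 0 ≤ B := intervalIntegral.integral_nonneg (by linarith) fun x _ => (hgpos x).le
  have hcube : (A + B) ^ 3 ≤ 4 * (A ^ 3 + B ^ 3) := by
    nlinarith [mul_nonneg (add_nonneg hA hB) (sq_nonneg (A - B))]
  linarith

/-- Integration by parts on `[0, 2π]` when the boundary terms agree. -/
theorem integral_mul_deriv_of_periodic {v v' w w' : ℝ → ℝ} (hv : ∀ x, HasDerivAt v (v' x) x)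
    (hw : ∀ x, HasDerivAt w (w' x) x) (cv' : Continuous v') (cw' : Continuous w')
    (pv : v (2 * π) = v 0) (pw : w (2 * π) = w 0) :
    ∫ x in (0:ℝ)..2 * π, v x * w' x = - ∫ x in (0:ℝ)..2 * π, v' x * w x := by
  rw [intervalIntegral.integral_mul_deriv_eq_deriv_mul (fun x _ => hv x) (fun x _ => hw x)
    (cv'.intervalIntegrable _ _) (cw'.intervalIntegrable _ _), pv, pw]
  ring

theorem integral_deriv_of_periodic {w w' : ℝ → ℝ} (hw : ∀ x, HasDerivAt w (w' x) x)
    (cw' : Continuous w') (pw : w (2 * π) = w 0) : ∫ x in (0:ℝ)..2 * π, w' x = 0 := by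
  rw [intervalIntegral.integral_eq_sub_of_hasDerivAt (fun x _ => hw x)
    (cw'.intervalIntegrable _ _), pw, sub_self]

/-- Minkowski's mixed area inequality for two functions on the circle. -/
theorem mixed_area_inequality {u u' u'' v v' v'' : ℝ → ℝ} (hu : ∀ x, HasDerivAt u (u' x) x)
    (hu' : ∀ x, HasDerivAt u' (u'' x) x) (cu : Continuous u'') (pu : u (2 * π) = u 0)
    (pu' : u' (2 * π) = u' 0) (hv : ∀ x, HasDerivAt v (v' x) x)
    (hv' : ∀ x, HasDerivAt v' (v'' x) x) (cv : Continuous v'') (pv : v (2 * π) = v 0)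
    (pv' : v' (2 * π) = v' 0) (ubar : 0 < ∫ x in (0:ℝ)..2 * π, u x)
    (vbar : 0 < ∫ x in (0:ℝ)..2 * π, v x)
    (Au : 0 ≤ ∫ x in (0:ℝ)..2 * π, u x * (u'' x + u x))
    (Av : 0 ≤ ∫ x in (0:ℝ)..2 * π, v x * (v'' x + v x)) :
    (∫ x in (0:ℝ)..2 * π, u x * (u'' x + u x)) * (∫ x in (0:ℝ)..2 * π, v x * (v'' x + v x)) ≤
      (∫ x in (0:ℝ)..2 * π, u x * (v'' x + v x)) ^ 2 := by
  have cont : ∀ {f f' : ℝ → ℝ}, (∀ x, HasDerivAt f (f' x) x) → Continuous f := fun h =>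
    continuous_iff_continuousAt.2 fun x => (h x).continuousAt
  have c1 := cont hu
  have c2 := cont hu'
  have c3 := cont hv
  have c4 := cont hv'
  have ii : ∀ {h : ℝ → ℝ} (_ : Continuous h), IntervalIntegrable h volume 0 (2 * π) :=
    fun h => h.intervalIntegrable _ _
  have symm : ∫ x in (0:ℝ)..2 * π, v x * (u'' x + u x) =
      ∫ x in (0:ℝ)..2 * π, u x * (v'' x + v x) := by
    have e1 := integral_mul_deriv_of_periodic hv hu' c4 cu pv pu'
    have e2 := integral_mul_deriv_of_periodic hu hv' c2 cv pu pv'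
    have e3 : ∫ x in (0:ℝ)..2 * π, v' x * u' x = ∫ x in (0:ℝ)..2 * π, u' x * v' x := by
      simp_rw [mul_comm]
    simp_rw [mul_add]
    rw [intervalIntegral.integral_add (ii (by fun_prop)) (ii (by fun_prop)),
      intervalIntegral.integral_add (ii (by fun_prop)) (ii (by fun_prop)), e1, e2, e3]
    simp_rw [mul_comm (u _) (v _)]
  set a := ∫ x in (0:ℝ)..2 * π, u x
  set b := ∫ x in (0:ℝ)..2 * π, v x
  have hw : ∀ x, HasDerivAt (fun x => a * v x - b * u x) (a * v' x - b * u' x) x := fun x =>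
    ((hv x).const_mul a).sub ((hu x).const_mul b)
  have hw' : ∀ x, HasDerivAt (fun x => a * v' x - b * u' x) (a * v'' x - b * u'' x) x := fun x =>
    ((hv' x).const_mul a).sub ((hu' x).const_mul b)
  have hmean : ∫ x in (0:ℝ)..2 * π, (a * v x - b * u x) = 0 := by
    rw [intervalIntegral.integral_sub (ii (by fun_prop)) (ii (by fun_prop)),
      intervalIntegral.integral_const_mul, intervalIntegral.integral_const_mul]
    ring
  have hW := wirtinger_inequality hw (by fun_prop) (by rw [pu, pv]) hmean
  have hparts := integral_mul_deriv_of_periodic hw hw' (by fun_prop) (by fun_prop)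
    (by rw [pu, pv]) (by rw [pu', pv'])
  simp_rw [← sq] at hparts
  have hneg : ∫ x in (0:ℝ)..2 * π,
      ((a * v x - b * u x) * (a * v'' x - b * u'' x) + (a * v x - b * u x) ^ 2) ≤ 0 := by
    rw [intervalIntegral.integral_add (ii (by fun_prop)) (ii (by fun_prop)), hparts]
    linarith
  have hexp : ∫ x in (0:ℝ)..2 * π,
      ((a * v x - b * u x) * (a * v'' x - b * u'' x) + (a * v x - b * u x) ^ 2) =
      a ^ 2 * (∫ x in (0:ℝ)..2 * π, v x * (v'' x + v x)) -
      a * b * (∫ x in (0:ℝ)..2 * π, v x * (u'' x + u x)) -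
      a * b * (∫ x in (0:ℝ)..2 * π, u x * (v'' x + v x)) +
      b ^ 2 * (∫ x in (0:ℝ)..2 * π, u x * (u'' x + u x)) := by
    simp_rw [← intervalIntegral.integral_const_mul]
    rw [← intervalIntegral.integral_sub (ii (by fun_prop)) (ii (by fun_prop)),
      ← intervalIntegral.integral_sub (ii (by fun_prop)) (ii (by fun_prop)),
      ← intervalIntegral.integral_add (ii (by fun_prop)) (ii (by fun_prop))]
    congr 1; ext x; ring
  rw [hexp, symm] at hneg
  set P := ∫ x in (0:ℝ)..2 * π, v x * (v'' x + v x)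
  set A := ∫ x in (0:ℝ)..2 * π, u x * (u'' x + u x)
  set B := ∫ x in (0:ℝ)..2 * π, u x * (v'' x + v x)
  have h1 : a ^ 2 * P + b ^ 2 * A ≤ 2 * (a * b * B) := by linarith
  have h2 : (a ^ 2 * P + b ^ 2 * A) ^ 2 ≤ (2 * (a * b * B)) ^ 2 := by
    have : 0 ≤ a ^ 2 * P + b ^ 2 * A := by positivity
    gcongr
  have h3 : (a * b) ^ 2 * (A * P) ≤ (a * b) ^ 2 * B ^ 2 := by
    nlinarith [sq_nonneg (a ^ 2 * P - b ^ 2 * A)]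
  exact le_of_mul_le_mul_left h3 (by positivity)

/-- A weak Blaschke–Santaló inequality for positive, possibly nonconvex, support functions. -/
theorem weak_santalo_inequality {u u' u'' : ℝ → ℝ} (hu : ∀ x, HasDerivAt u (u' x) x)
    (hu' : ∀ x, HasDerivAt u' (u'' x) x) (cu : Continuous u'') (pu : u (2 * π) = u 0)
    (pu' : u' (2 * π) = u' 0) (hpos : ∀ x, 0 < u x)
    (hcos : ∫ s in (0:ℝ)..2 * π, (u s ^ 3)⁻¹ * cos s = 0)
    (hsin : ∫ s in (0:ℝ)..2 * π, (u s ^ 3)⁻¹ * sin s = 0) :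
    (∫ x in (0:ℝ)..2 * π, u x * (u'' x + u x)) * (∫ x in (0:ℝ)..2 * π, (u x ^ 2)⁻¹) ≤ 64 := by
  have hpi := pi_pos
  have h2pi : (0:ℝ) < 2 * π := by positivity
  have c1 : Continuous u := continuous_iff_continuousAt.2 fun x => (hu x).continuousAt
  have hne : ∀ x, u x ≠ 0 := fun x => (hpos x).ne'
  set f : ℝ → ℝ := fun s => (u s ^ 3)⁻¹ with hf
  have cf : Continuous f := (c1.pow 3).inv₀ fun x => pow_ne_zero _ (hne x)
  have cg : Continuous fun s => (u s ^ 2)⁻¹ := (c1.pow 2).inv₀ fun x => pow_ne_zero _ (hne x)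
  have fpos : ∀ x, 0 < f x := fun x => by have := hpos x; positivity
  have gpos : ∀ x, 0 < (u x ^ 2)⁻¹ := fun x => by have := hpos x; positivity
  have iso := affine_length_cube_le_area cf cg fpos gpos
    (fun x => by simp only [hf]; rw [inv_pow, inv_pow]; ring) hcos hsin
  have hΩ : 0 < ∫ x in (0:ℝ)..2 * π, (u x ^ 2)⁻¹ :=
    intervalIntegral.intervalIntegral_pos_of_pos_on (cg.intervalIntegrable _ _)
      (fun x _ => gpos x) h2pi
  simp_rw [integral_mul_sin_sub cf] at iso
  set Cf : ℝ → ℝ := fun β => ∫ s in (0:ℝ)..β, f s * cos s with hC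
  set Sf : ℝ → ℝ := fun β => ∫ s in (0:ℝ)..β, f s * sin s with hS
  have dS : ∀ β, HasDerivAt Sf (f β * sin β) β := fun β =>
    hasDerivAt_integral_right (f := fun s => f s * sin s) (by fun_prop) 0 β
  have dC : ∀ β, HasDerivAt Cf (f β * cos β) β := fun β =>
    hasDerivAt_integral_right (f := fun s => f s * cos s) (by fun_prop) 0 β
  set J : ℝ → ℝ := fun x => sin x * Cf x - cos x * Sf x with hJ
  have dJ : ∀ x, HasDerivAt J (cos x * Cf x + sin x * Sf x) x := fun x => by
    refine HasDerivAt.congr_deriv (f := J)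
      (((hasDerivAt_sin x).mul (dC x)).sub ((hasDerivAt_cos x).mul (dS x))) ?_
    ring
  have dJ' : ∀ x, HasDerivAt (fun x => cos x * Cf x + sin x * Sf x) (f x - J x) x := fun x => by
    refine HasDerivAt.congr_deriv
      (((hasDerivAt_cos x).mul (dC x)).add ((hasDerivAt_sin x).mul (dS x))) ?_
    simp only [hJ]
    linear_combination f x * sin_sq_add_cos_sq x
  have cJ : Continuous J := continuous_iff_continuousAt.2 fun x => (dJ x).continuousAt
  have C0 : Cf 0 = 0 := by simp [hC]
  have S0 : Sf 0 = 0 := by simp [hS]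
  have C1 : Cf (2 * π) = 0 := hcos
  have S1 : Sf (2 * π) = 0 := hsin
  have hJf : ∀ x, f x - J x + J x = f x := fun x => by ring
  have huf : ∀ x, u x * f x = (u x ^ 2)⁻¹ := fun x => by
    simp only [hf]; have := hne x; field_simp
  rcases le_or_gt (∫ x in (0:ℝ)..2 * π, u x * (u'' x + u x)) 0 with hA | hA
  · have := mul_nonpos_of_nonpos_of_nonneg hA hΩ.le
    linarith
  have hbarJ : 0 < ∫ x in (0:ℝ)..2 * π, J x := by
    have h0 := integral_deriv_of_periodic dJ' (by fun_prop) (by simp [C0, C1, S0, S1])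
    rw [intervalIntegral.integral_sub (cf.intervalIntegrable _ _) (cJ.intervalIntegrable _ _),
      sub_eq_zero] at h0
    rw [← h0]
    exact intervalIntegral.intervalIntegral_pos_of_pos_on (cf.intervalIntegrable _ _)
      (fun x _ => fpos x) h2pi
  have hbaru : 0 < ∫ x in (0:ℝ)..2 * π, u x :=
    intervalIntegral.intervalIntegral_pos_of_pos_on (c1.intervalIntegrable _ _)
      (fun x _ => hpos x) h2pi
  set Ω := ∫ x in (0:ℝ)..2 * π, (u x ^ 2)⁻¹
  have hP : 0 < ∫ x in (0:ℝ)..2 * π, J x * f x := by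
    have : 0 < Ω ^ 3 := by positivity
    linarith
  have mink := mixed_area_inequality hu hu' cu pu pu' dJ dJ' (by fun_prop)
    (by simp [hJ, C0, C1, S0, S1]) (by simp [C0, C1, S0, S1]) hbaru hbarJ hA.le
    (by simp_rw [hJf]; exact hP.le)
  simp_rw [hJf, huf] at mink
  have h1 : Ω ^ 2 * ((∫ x in (0:ℝ)..2 * π, u x * (u'' x + u x)) * Ω) ≤ Ω ^ 2 * 64 := by
    have := mul_le_mul_of_nonneg_left iso hA.le
    nlinarith
  exact le_of_mul_le_mul_left h1 (by positivity)

/-- A nonnegative function with bounded integral whose growth is at most exponential while it is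
small tends to zero. -/
theorem tendsto_zero_of_deriv_le {F F' P p : ℝ → ℝ} {C δ T B : ℝ}
    (hF0 : ∀ t, T ≤ t → 0 ≤ F t) (hF : ∀ t, T ≤ t → HasDerivAt F (F' t) t)
    (hP : ∀ t, T ≤ t → HasDerivAt P (p t) t) (hp : ∀ t, T ≤ t → F t ≤ p t)
    (hB : ∀ t, T ≤ t → P t ≤ B) (hδ : 0 < δ) (hC : 0 ≤ C)
    (h : ∀ t, T ≤ t → F t ≤ δ → F' t ≤ C * F t) : Tendsto F atTop (𝓝 0) := by
  have hmono : MonotoneOn P (Set.Ici T) := by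
    refine monotoneOn_of_hasDerivWithinAt_nonneg (f' := p) (convex_Ici _)
      (fun x hx => (hP x hx).continuousAt.continuousWithinAt)
      (fun x hx => (hP x (interior_subset hx)).hasDerivWithinAt) (fun x hx => ?_)
    have hx' : T ≤ x := interior_subset hx
    exact (hF0 x hx').trans (hp x hx')
  rw [Metric.tendsto_atTop]
  intro ε hε
  set e := min ε δ with he
  have he0 : 0 < e := lt_min hε hδ
  set η := e / (2 * (C + 2)) with hη
  have hη0 : 0 < η := by positivity
  have hηe : (C + 2) * η = e / 2 := by rw [hη]; field_simp
  obtain ⟨s0, hs0, hlim⟩ : ∃ s0, T ≤ s0 ∧ ∀ t, s0 ≤ t → P t - P s0 ≤ η := by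
    have hbdd : BddAbove (P '' Set.Ici T) := ⟨B, by rintro _ ⟨t, ht, rfl⟩; exact hB t ht⟩
    obtain ⟨_, ⟨s0, hs0, rfl⟩, hlt⟩ := exists_lt_of_lt_csSup
      ((Set.nonempty_Ici (a := T)).image P) (sub_lt_self (sSup (P '' Set.Ici T)) hη0)
    refine ⟨s0, hs0, fun t ht => ?_⟩
    have := le_csSup hbdd (Set.mem_image_of_mem P (show t ∈ Set.Ici T from le_trans hs0 ht))
    linarith
  obtain ⟨s, hs, hps⟩ := exists_hasDerivAt_eq_slope P p (show s0 < s0 + 1 by linarith)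
    (fun x hx => (hP x (hs0.trans hx.1)).continuousAt.continuousWithinAt)
    (fun x hx => hP x (hs0.trans hx.1.le))
  have hsT : T ≤ s := hs0.trans hs.1.le
  have hFs : F s ≤ η := by
    have := hlim (s0 + 1) (by linarith)
    have h1 := hp s hsT
    rw [hps] at h1
    norm_num at h1
    linarith
  have hPs : ∀ t, s ≤ t → P t - P s ≤ η := fun t ht => by
    have := hlim t (hs.1.le.trans ht)
    have := hmono hs0 hsT hs.1.le
    linarith
  refine ⟨s, fun t ht => ?_⟩
  have hBle : ∀ x, s ≤ x → η + (C + 1) * (P x - P s) ≤ e / 2 := fun x hx => by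
    have := mul_le_mul_of_nonneg_left (hPs x hx) (by linarith : 0 ≤ C + 1)
    linarith
  have key := image_le_of_deriv_right_lt_deriv_boundary' (f := F) (f' := F') (a := s) (b := t)
    (B := fun x => η + (C + 1) * (P x - P s)) (B' := fun x => (C + 1) * p x)
    (fun x hx => (hF x (hsT.trans hx.1)).continuousAt.continuousWithinAt)
    (fun x hx => (hF x (hsT.trans hx.1)).hasDerivWithinAt) (by simpa using hFs)
    (fun x hx => ((((hP x (hsT.trans hx.1)).sub_const _).const_mul _).const_add
      _).continuousAt.continuousWithinAt)
    (fun x hx => ((((hP x (hsT.trans hx.1)).sub_const _).const_mul _).const_add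
      _).hasDerivWithinAt) ?_ (Set.right_mem_Icc.2 ht)
  · have h1 := hBle t ht
    have h2 := hF0 t (hsT.trans ht)
    have h3 : e ≤ ε := min_le_left _ _
    rw [Real.dist_eq, sub_zero, abs_of_nonneg h2]
    linarith
  · intro x hx hxB
    have hxT := hsT.trans hx.1
    have h1 := hBle x hx.1
    have h3 : e ≤ δ := min_le_right _ _
    have h4 := h x hxT (by linarith)
    have h5 : 0 ≤ P x - P s := sub_nonneg.2 (hmono hsT hxT hx.1)
    have h6 : 0 < F x := by rw [hxB]; positivity
    have h7 := mul_le_mul_of_nonneg_left (hp x hxT) (by linarith : 0 ≤ C + 1)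
    linarith

/-- Joint smoothness of a curried function of two real variables. -/
def JointlySmooth (f : ℝ → ℝ → ℝ) : Prop :=
  ContDiff ℝ (⊤ : ℕ∞) (fun p : ℝ × ℝ => f p.1 p.2)

/-- The partial derivative in the first variable. -/
noncomputable def partialFst (f : ℝ → ℝ → ℝ) (x t : ℝ) : ℝ := deriv (fun y => f y t) x

/-- The partial derivative in the second variable. -/
noncomputable def partialSnd (f : ℝ → ℝ → ℝ) (x t : ℝ) : ℝ := deriv (fun s => f x s) t

namespace JointlySmooth

variable {f : ℝ → ℝ → ℝ}

theorem hasFDerivAt (hf : JointlySmooth f) (p : ℝ × ℝ) :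
    HasFDerivAt (fun p : ℝ × ℝ => f p.1 p.2) (fderiv ℝ (fun p : ℝ × ℝ => f p.1 p.2) p) p :=
  (ContDiff.differentiable hf (by simp) p).hasFDerivAt

theorem hasDerivAt_fst' (hf : JointlySmooth f) (x t : ℝ) :
    HasDerivAt (fun y => f y t) (fderiv ℝ (fun p : ℝ × ℝ => f p.1 p.2) (x, t) (1, 0)) x :=
  HasFDerivAt.comp_hasDerivAt (f := fun y => (y, t)) x (hf.hasFDerivAt (x, t))
    ((hasDerivAt_id x).prodMk (hasDerivAt_const x t))

theorem hasDerivAt_snd' (hf : JointlySmooth f) (x t : ℝ) :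
    HasDerivAt (fun s => f x s) (fderiv ℝ (fun p : ℝ × ℝ => f p.1 p.2) (x, t) (0, 1)) t :=
  (hf.hasFDerivAt (x, t)).comp_hasDerivAt t ((hasDerivAt_const t x).prodMk (hasDerivAt_id t))

theorem partialFst_eq (hf : JointlySmooth f) (x t : ℝ) :
    partialFst f x t = fderiv ℝ (fun p : ℝ × ℝ => f p.1 p.2) (x, t) (1, 0) :=
  (hf.hasDerivAt_fst' x t).deriv

theorem partialSnd_eq (hf : JointlySmooth f) (x t : ℝ) :
    partialSnd f x t = fderiv ℝ (fun p : ℝ × ℝ => f p.1 p.2) (x, t) (0, 1) :=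
  (hf.hasDerivAt_snd' x t).deriv

theorem hasDerivAt_fst (hf : JointlySmooth f) (x t : ℝ) :
    HasDerivAt (fun y => f y t) (partialFst f x t) x :=
  hf.partialFst_eq x t ▸ hf.hasDerivAt_fst' x t

theorem hasDerivAt_snd (hf : JointlySmooth f) (x t : ℝ) :
    HasDerivAt (fun s => f x s) (partialSnd f x t) t :=
  hf.partialSnd_eq x t ▸ hf.hasDerivAt_snd' x t

theorem contDiff_fderiv (hf : JointlySmooth f) :
    ContDiff ℝ (⊤ : ℕ∞) (fderiv ℝ (fun p : ℝ × ℝ => f p.1 p.2)) :=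
  ContDiff.fderiv_right hf (by simp)

theorem partialFst (hf : JointlySmooth f) : JointlySmooth (partialFst f) := by
  have : ContDiff ℝ (⊤ : ℕ∞) (fun p : ℝ × ℝ =>
    fderiv ℝ (fun p : ℝ × ℝ => f p.1 p.2) p (1, 0)) :=
    hf.contDiff_fderiv.clm_apply contDiff_const
  simpa only [JointlySmooth, hf.partialFst_eq] using this

theorem partialSnd (hf : JointlySmooth f) : JointlySmooth (partialSnd f) := by
  have : ContDiff ℝ (⊤ : ℕ∞) (fun p : ℝ × ℝ =>
    fderiv ℝ (fun p : ℝ × ℝ => f p.1 p.2) p (0, 1)) :=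
    hf.contDiff_fderiv.clm_apply contDiff_const
  simpa only [JointlySmooth, hf.partialSnd_eq] using this

/-- Symmetry of mixed partial derivatives. -/
theorem partialSnd_partialFst (hf : JointlySmooth f) (x t : ℝ) :
    _root_.partialSnd (_root_.partialFst f) x t = _root_.partialFst (_root_.partialSnd f) x t := by
  set F := fun p : ℝ × ℝ => f p.1 p.2 with hF
  have h2 : HasFDerivAt (fderiv ℝ F) (fderiv ℝ (fderiv ℝ F) (x, t)) (x, t) :=
    (hf.contDiff_fderiv.differentiable (by simp) _).hasFDerivAt
  have hsymm := second_derivative_symmetric (f := F) (f' := fderiv ℝ F)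
    (f'' := fderiv ℝ (fderiv ℝ F) (x, t)) (fun y => hf.hasFDerivAt y) h2 (0, 1) (1, 0)
  have e1 : HasDerivAt (fun s => _root_.partialFst f x s)
      (fderiv ℝ (fderiv ℝ F) (x, t) (0, 1) (1, 0)) t := by
    simp only [hf.partialFst_eq]
    exact ((h2.clm_apply (hasFDerivAt_const ((1 : ℝ), (0 : ℝ)) (x, t))).comp_hasDerivAt t
      ((hasDerivAt_const t x).prodMk (hasDerivAt_id t))).congr_deriv (by simp)
  have e2 : HasDerivAt (fun y => _root_.partialSnd f y t)
      (fderiv ℝ (fderiv ℝ F) (x, t) (1, 0) (0, 1)) x := by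
    simp only [hf.partialSnd_eq]
    exact (HasFDerivAt.comp_hasDerivAt (f := fun y => (y, t)) x
      (h2.clm_apply (hasFDerivAt_const ((0 : ℝ), (1 : ℝ)) (x, t)))
      ((hasDerivAt_id x).prodMk (hasDerivAt_const x t))).congr_deriv (by simp)
  exact e1.deriv.trans (hsymm.trans e2.deriv.symm)

theorem continuous_fst (hf : JointlySmooth f) (t : ℝ) : Continuous fun x => f x t :=
  (ContDiff.continuous hf).comp (by fun_prop : Continuous fun x : ℝ => (x, t))

/-- Differentiation under the integral sign. -/
theorem hasDerivAt_integral (hf : JointlySmooth f) (a b t : ℝ) :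
    HasDerivAt (fun s => ∫ x in a..b, f x s) (∫ x in a..b, _root_.partialSnd f x t) t := by
  have hc : ContinuousOn (fun p : ℝ × ℝ => _root_.partialSnd f p.1 p.2)
      (Set.uIcc a b ×ˢ Metric.closedBall t 1) :=
    (ContDiff.continuous hf.partialSnd).continuousOn
  obtain ⟨C, hC⟩ := (isCompact_uIcc.prod (isCompact_closedBall t 1)).exists_bound_of_continuousOn hc
  refine (intervalIntegral.hasDerivAt_integral_of_dominated_loc_of_deriv_le
    (F := fun s x => f x s) (F' := fun s x => _root_.partialSnd f x s) (bound := fun _ => C)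
    (Metric.ball_mem_nhds t one_pos) ?_ ?_ ?_ ?_ ?_ ?_).2
  · exact Eventually.of_forall fun s => (hf.continuous_fst s).aestronglyMeasurable
  · exact (hf.continuous_fst t).intervalIntegrable _ _
  · exact (hf.partialSnd.continuous_fst t).aestronglyMeasurable
  · refine Eventually.of_forall fun x hx s hs => hC (x, s) ⟨?_, Metric.ball_subset_closedBall hs⟩
    exact Set.uIoc_subset_uIcc hx
  · exact continuous_const.intervalIntegrable _ _
  · exact Eventually.of_forall fun x _ s _ => hf.hasDerivAt_snd x s

end JointlySmooth

theorem partialFst_add_period {f : ℝ → ℝ → ℝ} {c : ℝ} (hper : ∀ x t, f (x + c) t = f x t)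
    (x t : ℝ) : partialFst f (x + c) t = partialFst f x t := by
  have h : (fun y => f (y + c) t) = fun y => f y t := funext fun y => hper y t
  rw [partialFst, ← deriv_comp_add_const, h, partialFst]

/-- The normalized affine flow on the circle, in terms of the support function `u`, the affine
curvature `κ` and its mean `κb`. -/
structure IsAffineFlow (u κ : ℝ → ℝ → ℝ) (κb : ℝ → ℝ) : Prop where
  smooth : JointlySmooth u
  periodic : ∀ θ t, u (θ + 2 * π) t = u θ t
  pos : ∀ θ t, 0 < u θ t
  curvature : ∀ θ t, κ θ t = u θ t ^ 3 * (partialFst (partialFst u) θ t + u θ t)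
  mean : ∀ t, κb t = (∫ θ in (0:ℝ)..(2 * π), κ θ t * (u θ t ^ 2)⁻¹) /
    ∫ θ in (0:ℝ)..(2 * π), (u θ t ^ 2)⁻¹
  flow : ∀ θ t, 0 ≤ t → partialSnd u θ t = (1 / 4) * (κ θ t - κb t) * u θ t
  normalized : ∫ θ in (0:ℝ)..(2 * π), (u θ 0 ^ 2)⁻¹ = 2 * π

namespace IsAffineFlow

variable {u κ : ℝ → ℝ → ℝ} {κb : ℝ → ℝ}

theorem smooth_curvature (h : IsAffineFlow u κ κb) : JointlySmooth κ := by
  have e : κ = fun θ t => u θ t ^ 3 * (partialFst (partialFst u) θ t + u θ t) :=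
    funext fun θ => funext fun t => h.curvature θ t
  rw [e]
  exact (ContDiff.pow h.smooth 3).mul (ContDiff.add h.smooth.partialFst.partialFst h.smooth)

theorem curvature_periodic (h : IsAffineFlow u κ κb) (θ t : ℝ) : κ (θ + 2 * π) t = κ θ t := by
  simp only [h.curvature, h.periodic,
    partialFst_add_period (partialFst_add_period h.periodic)]

theorem smooth_inv_pow (h : IsAffineFlow u κ κb) (n : ℕ) :
    JointlySmooth fun θ t => (u θ t ^ n)⁻¹ :=
  (ContDiff.pow h.smooth n).inv fun p => (pow_pos (h.pos p.1 p.2) n).ne'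

/-- The flux `u² ∂κ/∂θ`, i.e. the derivative of `κ` with respect to affine arclength. -/
theorem smooth_flux (h : IsAffineFlow u κ κb) :
    JointlySmooth fun θ t => u θ t ^ 2 * partialFst κ θ t :=
  (ContDiff.pow h.smooth 2).mul h.smooth_curvature.partialFst

theorem flux_periodic (h : IsAffineFlow u κ κb) (θ t : ℝ) :
    u (θ + 2 * π) t ^ 2 * partialFst κ (θ + 2 * π) t = u θ t ^ 2 * partialFst κ θ t := by
  rw [h.periodic, partialFst_add_period h.curvature_periodic]

theorem partialFst_flux (h : IsAffineFlow u κ κb) (θ t : ℝ) :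
    partialFst (fun θ t => u θ t ^ 2 * partialFst κ θ t) θ t =
      2 * u θ t * partialFst u θ t * partialFst κ θ t +
        u θ t ^ 2 * partialFst (partialFst κ) θ t := by
  have := ((h.smooth.hasDerivAt_fst θ t).pow 2).mul
    (h.smooth_curvature.partialFst.hasDerivAt_fst θ t)
  refine (this.congr_deriv ?_).deriv
  simp

/-- The evolution equation of the affine curvature. -/
theorem partialSnd_curvature (h : IsAffineFlow u κ κb) (θ : ℝ) {t : ℝ} (ht : 0 ≤ t) :
    partialSnd κ θ t =
      (1 / 4) * u θ t ^ 2 * partialFst (fun θ t => u θ t ^ 2 * partialFst κ θ t) θ t +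
        (κ θ t - κb t) * κ θ t := by
  have e0 : (fun y => partialSnd u y t) = fun y => (1 / 4) * (κ y t - κb t) * u y t :=
    funext fun y => h.flow y t ht
  have e1 : ∀ y, partialSnd (partialFst u) y t =
      (1 / 4) * (partialFst κ y t * u y t + (κ y t - κb t) * partialFst u y t) := fun y => by
    rw [h.smooth.partialSnd_partialFst]
    have := (((h.smooth_curvature.hasDerivAt_fst y t).sub_const (κb t)).const_mul (1 / 4)).mul
      (h.smooth.hasDerivAt_fst y t)
    have e : partialFst (partialSnd u) y t = deriv (fun y => partialSnd u y t) y := rfl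
    rw [e, e0]
    refine (this.congr_deriv ?_).deriv
    ring
  have e2 : partialSnd (partialFst (partialFst u)) θ t =
      (1 / 4) * (partialFst (partialFst κ) θ t * u θ t + 2 * partialFst κ θ t * partialFst u θ t +
        (κ θ t - κb t) * partialFst (partialFst u) θ t) := by
    rw [h.smooth.partialFst.partialSnd_partialFst]
    have := ((((h.smooth_curvature.partialFst.hasDerivAt_fst θ t).mul
      (h.smooth.hasDerivAt_fst θ t)).add
        (((h.smooth_curvature.hasDerivAt_fst θ t).sub_const (κb t)).mul
          (h.smooth.partialFst.hasDerivAt_fst θ t)))).const_mul (1 / 4)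
    have e : partialFst (partialSnd (partialFst u)) θ t =
      deriv (fun y => partialSnd (partialFst u) y t) θ := rfl
    rw [e, funext e1]
    refine (this.congr_deriv ?_).deriv
    ring
  have hk : (fun s => κ θ s) = fun s => u θ s ^ 3 * (partialFst (partialFst u) θ s + u θ s) :=
    funext fun s => h.curvature θ s
  have := ((h.smooth.hasDerivAt_snd θ t).pow 3).mul
    ((h.smooth.partialFst.partialFst.hasDerivAt_snd θ t).add (h.smooth.hasDerivAt_snd θ t))
  have e : partialSnd κ θ t = deriv (fun s => κ θ s) t := rfl
  rw [e, hk]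
  refine (this.congr_deriv ?_).deriv
  rw [e2, h.flow θ t ht, h.partialFst_flux]
  simp only [h.curvature θ t, Pi.add_apply, Pi.pow_apply]
  push_cast
  ring

theorem inv_sq_pos (h : IsAffineFlow u κ κb) (θ t : ℝ) : 0 < (u θ t ^ 2)⁻¹ :=
  inv_pos.2 (pow_pos (h.pos θ t) 2)

theorem partialSnd_inv_sq (h : IsAffineFlow u κ κb) (θ : ℝ) {t : ℝ} (ht : 0 ≤ t) :
    partialSnd (fun θ t => (u θ t ^ 2)⁻¹) θ t =
      -(1 / 2) * ((κ θ t - κb t) * (u θ t ^ 2)⁻¹) := by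
  have hu := (h.pos θ t).ne'
  have := ((h.smooth.hasDerivAt_snd θ t).pow 2).inv (pow_ne_zero 2 hu)
  refine (this.congr_deriv ?_).deriv
  rw [h.flow θ t ht]
  simp only [Pi.pow_apply]
  field_simp
  push_cast
  ring

theorem length_pos (h : IsAffineFlow u κ κb) (t : ℝ) :
    0 < ∫ θ in (0:ℝ)..(2 * π), (u θ t ^ 2)⁻¹ :=
  intervalIntegral.intervalIntegral_pos_of_pos_on
    ((h.smooth_inv_pow 2).continuous_fst t |>.intervalIntegrable _ _)
    (fun θ _ => h.inv_sq_pos θ t) (by positivity)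

theorem integral_curvature (h : IsAffineFlow u κ κb) (t : ℝ) :
    ∫ θ in (0:ℝ)..(2 * π), κ θ t * (u θ t ^ 2)⁻¹ =
      κb t * ∫ θ in (0:ℝ)..(2 * π), (u θ t ^ 2)⁻¹ := by
  rw [h.mean, div_mul_cancel₀ _ (h.length_pos t).ne']

theorem integral_deviation (h : IsAffineFlow u κ κb) (t : ℝ) :
    ∫ θ in (0:ℝ)..(2 * π), (κ θ t - κb t) * (u θ t ^ 2)⁻¹ = 0 := by
  have ck := h.smooth_curvature.continuous_fst t
  have cg := (h.smooth_inv_pow 2).continuous_fst t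
  simp only [sub_mul]
  rw [intervalIntegral.integral_sub, h.integral_curvature,
    intervalIntegral.integral_const_mul, sub_self]
  all_goals exact Continuous.intervalIntegrable (by fun_prop) _ _

theorem length_eq (h : IsAffineFlow u κ κb) {t : ℝ} (ht : 0 ≤ t) :
    ∫ θ in (0:ℝ)..(2 * π), (u θ t ^ 2)⁻¹ = 2 * π := by
  have hd : ∀ s, 0 ≤ s → HasDerivAt (fun t => ∫ θ in (0:ℝ)..(2 * π), (u θ t ^ 2)⁻¹) 0 s := by
    intro s hs
    refine ((h.smooth_inv_pow 2).hasDerivAt_integral 0 (2 * π) s).congr_deriv ?_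
    simp only [h.partialSnd_inv_sq _ hs]
    rw [intervalIntegral.integral_const_mul, h.integral_deviation, mul_zero]
  have := constant_of_has_deriv_right_zero (a := 0) (b := t)
    (fun s hs => (hd s hs.1).continuousAt.continuousWithinAt)
    (fun s hs => (hd s hs.1).hasDerivWithinAt) t (Set.right_mem_Icc.2 ht)
  exact this.trans h.normalized

theorem smooth_curvature_density (h : IsAffineFlow u κ κb) (n : ℕ) :
    JointlySmooth fun θ t => κ θ t ^ n * (u θ t ^ 2)⁻¹ :=
  (ContDiff.pow h.smooth_curvature n).mul (h.smooth_inv_pow 2)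

/-- The variance of the affine curvature with respect to affine arclength. -/
theorem integral_sq_deviation (h : IsAffineFlow u κ κb) (t : ℝ) :
    ∫ θ in (0:ℝ)..(2 * π), (κ θ t - κb t) ^ 2 * (u θ t ^ 2)⁻¹ =
      (∫ θ in (0:ℝ)..(2 * π), κ θ t ^ 2 * (u θ t ^ 2)⁻¹) -
        κb t * ∫ θ in (0:ℝ)..(2 * π), κ θ t ^ 1 * (u θ t ^ 2)⁻¹ := by
  have c2 := (h.smooth_curvature_density 2).continuous_fst t
  have c1 := (h.smooth_curvature_density 1).continuous_fst t
  have ck := h.smooth_curvature.continuous_fst t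
  have cg := (h.smooth_inv_pow 2).continuous_fst t
  have e : ∀ θ, (κ θ t - κb t) ^ 2 * (u θ t ^ 2)⁻¹ = κ θ t ^ 2 * (u θ t ^ 2)⁻¹ -
    κb t * (κ θ t ^ 1 * (u θ t ^ 2)⁻¹) - κb t * ((κ θ t - κb t) * (u θ t ^ 2)⁻¹) :=
    fun θ => by ring
  simp only [e]
  rw [intervalIntegral.integral_sub, intervalIntegral.integral_sub,
    intervalIntegral.integral_const_mul, intervalIntegral.integral_const_mul,
    h.integral_deviation, mul_zero, sub_zero]
  all_goals exact Continuous.intervalIntegrable (by fun_prop) _ _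

theorem partialSnd_curvature_density (h : IsAffineFlow u κ κb) (n : ℕ) (θ : ℝ) {t : ℝ}
    (ht : 0 ≤ t) :
    partialSnd (fun θ t => κ θ t ^ (n + 1) * (u θ t ^ 2)⁻¹) θ t =
      (n + 1) / 4 * (κ θ t ^ n *
        partialFst (fun θ t => u θ t ^ 2 * partialFst κ θ t) θ t) +
      (n + 1 / 2) * ((κ θ t - κb t) * κ θ t ^ (n + 1) * (u θ t ^ 2)⁻¹) := by
  have hu := (h.pos θ t).ne'
  have := ((h.smooth_curvature.hasDerivAt_snd θ t).pow (n + 1)).mul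
    ((h.smooth_inv_pow 2).hasDerivAt_snd θ t)
  refine (this.congr_deriv ?_).deriv
  rw [h.partialSnd_inv_sq θ ht, h.partialSnd_curvature θ ht]
  simp only [Pi.pow_apply, Nat.add_sub_cancel]
  push_cast
  field_simp
  ring

theorem integral_deviation_mul_curvature (h : IsAffineFlow u κ κb) (t : ℝ) :
    ∫ θ in (0:ℝ)..(2 * π), (κ θ t - κb t) * κ θ t ^ 1 * (u θ t ^ 2)⁻¹ =
      ∫ θ in (0:ℝ)..(2 * π), (κ θ t - κb t) ^ 2 * (u θ t ^ 2)⁻¹ := by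
  have ck := h.smooth_curvature.continuous_fst t
  have cg := (h.smooth_inv_pow 2).continuous_fst t
  have e : ∀ θ, (κ θ t - κb t) * κ θ t ^ 1 * (u θ t ^ 2)⁻¹ = (κ θ t - κb t) ^ 2 * (u θ t ^ 2)⁻¹ +
    κb t * ((κ θ t - κb t) * (u θ t ^ 2)⁻¹) := fun θ => by ring
  simp only [e]
  rw [intervalIntegral.integral_add, intervalIntegral.integral_const_mul,
    h.integral_deviation, mul_zero, add_zero]
  all_goals exact Continuous.intervalIntegrable (by fun_prop) _ _

theorem integral_deviation_mul_sq_curvature (h : IsAffineFlow u κ κb) (t : ℝ) :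
    ∫ θ in (0:ℝ)..(2 * π), (κ θ t - κb t) * κ θ t ^ 2 * (u θ t ^ 2)⁻¹ =
      (∫ θ in (0:ℝ)..(2 * π), (κ θ t - κb t) ^ 3 * (u θ t ^ 2)⁻¹) +
      2 * κb t * ∫ θ in (0:ℝ)..(2 * π), (κ θ t - κb t) ^ 2 * (u θ t ^ 2)⁻¹ := by
  have ck := h.smooth_curvature.continuous_fst t
  have cg := (h.smooth_inv_pow 2).continuous_fst t
  have e : ∀ θ, (κ θ t - κb t) * κ θ t ^ 2 * (u θ t ^ 2)⁻¹ = (κ θ t - κb t) ^ 3 * (u θ t ^ 2)⁻¹ +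
    2 * κb t * ((κ θ t - κb t) ^ 2 * (u θ t ^ 2)⁻¹) +
    κb t ^ 2 * ((κ θ t - κb t) * (u θ t ^ 2)⁻¹) := fun θ => by ring
  simp only [e]
  rw [intervalIntegral.integral_add, intervalIntegral.integral_add,
    intervalIntegral.integral_const_mul, intervalIntegral.integral_const_mul,
    h.integral_deviation, mul_zero, add_zero]
  all_goals exact Continuous.intervalIntegrable (by fun_prop) _ _

theorem integral_partialFst_flux_mul (h : IsAffineFlow u κ κb) (t : ℝ) {v v' : ℝ → ℝ}
    (hv : ∀ θ, HasDerivAt v (v' θ) θ) (cv' : Continuous v') (pv : v (2 * π) = v 0) :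
    ∫ θ in (0:ℝ)..(2 * π), v θ * partialFst (fun θ t => u θ t ^ 2 * partialFst κ θ t) θ t =
      -∫ θ in (0:ℝ)..(2 * π), v' θ * (u θ t ^ 2 * partialFst κ θ t) :=
  integral_mul_deriv_of_periodic hv (fun θ => h.smooth_flux.hasDerivAt_fst θ t) cv'
    (h.smooth_flux.partialFst.continuous_fst t) pv (by simpa using h.flux_periodic 0 t)

theorem hasDerivAt_total_curvature (h : IsAffineFlow u κ κb) {t : ℝ} (ht : 0 ≤ t) :
    HasDerivAt (fun t => ∫ θ in (0:ℝ)..(2 * π), κ θ t ^ 1 * (u θ t ^ 2)⁻¹)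
      ((1 / 2) * ∫ θ in (0:ℝ)..(2 * π), (κ θ t - κb t) ^ 2 * (u θ t ^ 2)⁻¹) t := by
  have ck := h.smooth_curvature.continuous_fst t
  have cg := (h.smooth_inv_pow 2).continuous_fst t
  have cq := h.smooth_flux.partialFst.continuous_fst t
  refine ((h.smooth_curvature_density 1).hasDerivAt_integral 0 (2 * π) t).congr_deriv ?_
  have e := fun θ => h.partialSnd_curvature_density 0 θ ht
  simp only [zero_add, CharP.cast_eq_zero, pow_zero] at e
  simp only [e]
  rw [intervalIntegral.integral_add, intervalIntegral.integral_const_mul,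
    intervalIntegral.integral_const_mul (1 / 2), h.integral_deviation_mul_curvature,
    h.integral_partialFst_flux_mul t (fun θ => hasDerivAt_const θ 1) continuous_const rfl]
  · simp
  all_goals exact Continuous.intervalIntegrable (by fun_prop) _ _

theorem hasDerivAt_mean_curvature (h : IsAffineFlow u κ κb) {t : ℝ} (ht : 0 ≤ t) :
    HasDerivAt κb
      ((∫ θ in (0:ℝ)..(2 * π), (κ θ t - κb t) ^ 2 * (u θ t ^ 2)⁻¹) / (4 * π)) t := by
  have e : κb = fun t => (∫ θ in (0:ℝ)..(2 * π), κ θ t ^ 1 * (u θ t ^ 2)⁻¹) /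
      ∫ θ in (0:ℝ)..(2 * π), (u θ t ^ 2)⁻¹ := funext fun t => by simpa using h.mean t
  have h1 : HasDerivAt (fun t => ∫ θ in (0:ℝ)..(2 * π), (u θ t ^ 2)⁻¹) 0 t := by
    refine ((h.smooth_inv_pow 2).hasDerivAt_integral 0 (2 * π) t).congr_deriv ?_
    simp only [h.partialSnd_inv_sq _ ht]
    rw [intervalIntegral.integral_const_mul, h.integral_deviation, mul_zero]
  have h2 := (h.hasDerivAt_total_curvature ht).div h1 (h.length_pos t).ne'
  refine (h2.congr_of_eventuallyEq (Eventually.of_forall (congrFun e))).congr_deriv ?_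
  rw [h.length_eq ht]
  have := pi_pos
  field_simp
  ring

theorem hasDerivAt_total_sq_curvature (h : IsAffineFlow u κ κb) {t : ℝ} (ht : 0 ≤ t) :
    HasDerivAt (fun t => ∫ θ in (0:ℝ)..(2 * π), κ θ t ^ 2 * (u θ t ^ 2)⁻¹)
      (-(1 / 2) * (∫ θ in (0:ℝ)..(2 * π), u θ t ^ 2 * partialFst κ θ t ^ 2) +
        (3 / 2) * ((∫ θ in (0:ℝ)..(2 * π), (κ θ t - κb t) ^ 3 * (u θ t ^ 2)⁻¹) +
        2 * κb t * ∫ θ in (0:ℝ)..(2 * π), (κ θ t - κb t) ^ 2 * (u θ t ^ 2)⁻¹)) t := by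
  have ck := h.smooth_curvature.continuous_fst t
  have cg := (h.smooth_inv_pow 2).continuous_fst t
  have cq := h.smooth_flux.partialFst.continuous_fst t
  refine ((h.smooth_curvature_density 2).hasDerivAt_integral 0 (2 * π) t).congr_deriv ?_
  have e := fun θ => h.partialSnd_curvature_density 1 θ ht
  simp only [Nat.cast_one, Nat.reduceAdd, pow_one] at e
  simp only [e]
  rw [intervalIntegral.integral_add, intervalIntegral.integral_const_mul,
    intervalIntegral.integral_const_mul, h.integral_deviation_mul_sq_curvature,
    h.integral_partialFst_flux_mul t (fun θ => h.smooth_curvature.hasDerivAt_fst θ t)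
      (h.smooth_curvature.partialFst.continuous_fst t) (by simpa using h.curvature_periodic 0 t)]
  · have e' : ∀ θ, partialFst κ θ t * (u θ t ^ 2 * partialFst κ θ t) =
      u θ t ^ 2 * partialFst κ θ t ^ 2 := fun θ => by ring
    simp only [e']
    ring
  all_goals exact Continuous.intervalIntegrable (by fun_prop) _ _

/-- Evolution of the variance of the affine curvature. -/
theorem hasDerivAt_variance (h : IsAffineFlow u κ κb) {t : ℝ} (ht : 0 ≤ t) :
    HasDerivAt (fun t => ∫ θ in (0:ℝ)..(2 * π), (κ θ t - κb t) ^ 2 * (u θ t ^ 2)⁻¹)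
      (-(1 / 2) * (∫ θ in (0:ℝ)..(2 * π), u θ t ^ 2 * partialFst κ θ t ^ 2) +
        (3 / 2) * (∫ θ in (0:ℝ)..(2 * π), (κ θ t - κb t) ^ 3 * (u θ t ^ 2)⁻¹) +
        2 * κb t * ∫ θ in (0:ℝ)..(2 * π), (κ θ t - κb t) ^ 2 * (u θ t ^ 2)⁻¹) t := by
  rw [funext h.integral_sq_deviation]
  have := (h.hasDerivAt_total_sq_curvature ht).sub
    ((h.hasDerivAt_mean_curvature ht).mul (h.hasDerivAt_total_curvature ht))
  refine this.congr_deriv ?_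
  have e : ∫ θ in (0:ℝ)..(2 * π), κ θ t ^ 1 * (u θ t ^ 2)⁻¹ = κb t * (2 * π) := by
    have := h.integral_curvature t
    rw [h.length_eq ht] at this
    simpa using this
  rw [e]
  have := pi_pos
  field_simp
  ring

/-- Evolution of the Dirichlet energy of the affine curvature. -/
theorem hasDerivAt_energy (h : IsAffineFlow u κ κb) {t : ℝ} (ht : 0 ≤ t) :
    HasDerivAt (fun t => ∫ θ in (0:ℝ)..(2 * π), u θ t ^ 2 * partialFst κ θ t ^ 2)
      ((∫ θ in (0:ℝ)..(2 * π), ((9 / 2) * (κ θ t - κb t) + 2 * κb t) *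
          (u θ t ^ 2 * partialFst κ θ t ^ 2)) -
        (1 / 2) * ∫ θ in (0:ℝ)..(2 * π), u θ t ^ 2 *
          partialFst (fun θ t => u θ t ^ 2 * partialFst κ θ t) θ t ^ 2) t := by
  have hk := h.smooth_curvature
  have hkt := hk.partialSnd
  have hs : JointlySmooth fun θ t => u θ t ^ 2 * partialFst κ θ t ^ 2 :=
    (ContDiff.pow h.smooth 2).mul (ContDiff.pow hk.partialFst 2)
  have cu := h.smooth.continuous_fst t
  have ck := hk.continuous_fst t
  have ck' := hk.partialFst.continuous_fst t
  have cq := h.smooth_flux.partialFst.continuous_fst t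
  have ckt' := hkt.partialFst.continuous_fst t
  refine (hs.hasDerivAt_integral 0 (2 * π) t).congr_deriv ?_
  have e : ∀ θ, partialSnd (fun θ t => u θ t ^ 2 * partialFst κ θ t ^ 2) θ t =
      (1 / 2) * ((κ θ t - κb t) * (u θ t ^ 2 * partialFst κ θ t ^ 2)) +
      2 * (u θ t ^ 2 * partialFst κ θ t * partialFst (partialSnd κ) θ t) := fun θ => by
    have := ((h.smooth.hasDerivAt_snd θ t).pow 2).mul ((hk.partialFst.hasDerivAt_snd θ t).pow 2)
    refine (this.congr_deriv ?_).deriv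
    rw [h.flow θ t ht, hk.partialSnd_partialFst]
    simp only [Pi.pow_apply]
    push_cast
    ring
  have hparts := integral_mul_deriv_of_periodic (fun θ => h.smooth_flux.hasDerivAt_fst θ t)
    (fun θ => hkt.hasDerivAt_fst θ t) cq ckt' (by simpa using h.flux_periodic 0 t) (by
      have e1 : partialSnd κ (2 * π) t = partialSnd κ 0 t := by
        have : (fun s => κ (2 * π) s) = fun s => κ 0 s :=
          funext fun s => by simpa using h.curvature_periodic 0 s
        rw [partialSnd, this, partialSnd]
      exact e1)
  have hparts' := h.integral_partialFst_flux_mul t (v := fun θ => (κ θ t - κb t) * κ θ t)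
    (fun θ => ((hk.hasDerivAt_fst θ t).sub_const (κb t)).mul (hk.hasDerivAt_fst θ t))
    (by fun_prop) (by have := h.curvature_periodic 0 t; rw [zero_add] at this; simp only [this])
  have e2 : ∀ θ, partialFst (fun θ t => u θ t ^ 2 * partialFst κ θ t) θ t * partialSnd κ θ t =
      (1 / 4) * (u θ t ^ 2 * partialFst (fun θ t => u θ t ^ 2 * partialFst κ θ t) θ t ^ 2) +
      (κ θ t - κb t) * κ θ t * partialFst (fun θ t => u θ t ^ 2 * partialFst κ θ t) θ t :=
    fun θ => by rw [h.partialSnd_curvature θ ht]; ring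
  simp only [e2] at hparts
  rw [intervalIntegral.integral_add, intervalIntegral.integral_const_mul, hparts'] at hparts
  · simp only [e]
    rw [intervalIntegral.integral_add, intervalIntegral.integral_const_mul,
      intervalIntegral.integral_const_mul, hparts]
    · have e3 : ∀ θ, ((9 / 2) * (κ θ t - κb t) + 2 * κb t) *
          (u θ t ^ 2 * partialFst κ θ t ^ 2) =
        (1 / 2) * ((κ θ t - κb t) * (u θ t ^ 2 * partialFst κ θ t ^ 2)) +
        2 * ((partialFst κ θ t * κ θ t + (κ θ t - κb t) * partialFst κ θ t) *
          (u θ t ^ 2 * partialFst κ θ t)) := fun θ => by ring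
      simp only [e3]
      rw [intervalIntegral.integral_add, intervalIntegral.integral_const_mul,
        intervalIntegral.integral_const_mul]
      · ring
      all_goals exact Continuous.intervalIntegrable (by fun_prop) _ _
    all_goals exact Continuous.intervalIntegrable (by fun_prop) _ _
  all_goals exact Continuous.intervalIntegrable (by fun_prop) _ _

/-- The flow preserves orthogonality of `u⁻³` to the solutions of `φ'' = -φ`. -/
theorem integral_inv_cube_mul_eq_zero (h : IsAffineFlow u κ κb) {φ φ' : ℝ → ℝ}
    (sφ : ContDiff ℝ (⊤ : ℕ∞) φ) (hφ : ∀ θ, HasDerivAt φ (φ' θ) θ)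
    (hφ' : ∀ θ, HasDerivAt φ' (-φ θ) θ) (pφ : φ (2 * π) = φ 0) (pφ' : φ' (2 * π) = φ' 0)
    (h0 : ∫ θ in (0:ℝ)..(2 * π), (u θ 0 ^ 3)⁻¹ * φ θ = 0) {t : ℝ} (ht : 0 ≤ t) :
    ∫ θ in (0:ℝ)..(2 * π), (u θ t ^ 3)⁻¹ * φ θ = 0 := by
  have hs : JointlySmooth fun θ t => (u θ t ^ 3)⁻¹ * φ θ :=
    (h.smooth_inv_pow 3).mul (sφ.comp contDiff_fst)
  have cφ : Continuous φ := sφ.continuous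
  have cφ' : Continuous φ' := continuous_iff_continuousAt.2 fun x => (hφ' x).continuousAt
  have hd : ∀ s, 0 ≤ s → HasDerivAt (fun t => ∫ θ in (0:ℝ)..(2 * π), (u θ t ^ 3)⁻¹ * φ θ)
      ((3 / 4) * κb s * ∫ θ in (0:ℝ)..(2 * π), (u θ s ^ 3)⁻¹ * φ θ) s := by
    intro s hs0
    refine (hs.hasDerivAt_integral 0 (2 * π) s).congr_deriv ?_
    have cu := h.smooth.continuous_fst s
    have cu' := h.smooth.partialFst.continuous_fst s
    have cu'' := h.smooth.partialFst.partialFst.continuous_fst s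
    have c3 := (h.smooth_inv_pow 3).continuous_fst s
    have e : ∀ θ, partialSnd (fun θ t => (u θ t ^ 3)⁻¹ * φ θ) θ s =
        (3 / 4) * κb s * ((u θ s ^ 3)⁻¹ * φ θ) -
          (3 / 4) * (φ θ * partialFst (partialFst u) θ s + φ θ * u θ s) := fun θ => by
      have hu := (h.pos θ s).ne'
      have := (((h.smooth.hasDerivAt_snd θ s).pow 3).inv (pow_ne_zero 3 hu)).mul_const (φ θ)
      refine (this.congr_deriv ?_).deriv
      rw [h.flow θ s hs0, h.curvature]
      simp only [Pi.pow_apply]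
      field_simp
      push_cast
      ring
    have p1 := integral_mul_deriv_of_periodic hφ (fun θ => h.smooth.partialFst.hasDerivAt_fst θ s)
      cφ' cu'' pφ (by simpa using partialFst_add_period h.periodic 0 s)
    have p2 := integral_mul_deriv_of_periodic hφ' (fun θ => h.smooth.hasDerivAt_fst θ s)
      cφ.neg cu' pφ' (by simpa using h.periodic 0 s)
    simp only [neg_mul, intervalIntegral.integral_neg, neg_neg] at p2
    simp only [e]
    rw [intervalIntegral.integral_sub, intervalIntegral.integral_const_mul,
      intervalIntegral.integral_const_mul, intervalIntegral.integral_add, p1, p2]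
    · ring
    all_goals exact Continuous.intervalIntegrable (by fun_prop) _ _
  have cκ : ContinuousOn κb (Set.Icc 0 t) := fun s hs =>
    (h.hasDerivAt_mean_curvature hs.1).continuousAt.continuousWithinAt
  obtain ⟨K, hK⟩ := isCompact_Icc.exists_bound_of_continuousOn cκ
  refine eq_zero_of_abs_deriv_le_mul_abs_self_of_eq_zero_right (K := (3 / 4) * K)
    (fun s hs => (hd s hs.1).continuousAt.continuousWithinAt)
    (fun s hs => (hd s hs.1).hasDerivWithinAt) h0 (fun s hs => ?_) t (Set.right_mem_Icc.2 ht)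
  have := hK s ⟨hs.1, hs.2.le⟩
  rw [norm_mul, norm_mul]
  gcongr
  norm_num

theorem mean_curvature_le (h : IsAffineFlow u κ κb)
    (hcos : ∫ θ in (0:ℝ)..(2 * π), (u θ 0 ^ 3)⁻¹ * cos θ = 0)
    (hsin : ∫ θ in (0:ℝ)..(2 * π), (u θ 0 ^ 3)⁻¹ * sin θ = 0) {t : ℝ} (ht : 0 ≤ t) :
    κb t ≤ 64 / (2 * π) ^ 2 := by
  have c := h.integral_inv_cube_mul_eq_zero contDiff_cos (φ' := fun x => -sin x)
    hasDerivAt_cos (fun x => (hasDerivAt_sin x).neg) (by simp) (by simp) hcos ht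
  have s := h.integral_inv_cube_mul_eq_zero contDiff_sin hasDerivAt_sin
    hasDerivAt_cos (by simp) (by simp) hsin ht
  have key := weak_santalo_inequality (fun θ => h.smooth.hasDerivAt_fst θ t)
    (fun θ => h.smooth.partialFst.hasDerivAt_fst θ t)
    (h.smooth.partialFst.partialFst.continuous_fst t) (by simpa using h.periodic 0 t)
    (by simpa using partialFst_add_period h.periodic 0 t) (fun θ => h.pos θ t) c s
  have e : ∀ θ, u θ t * (partialFst (partialFst u) θ t + u θ t) = κ θ t * (u θ t ^ 2)⁻¹ :=
    fun θ => by
      have := (h.pos θ t).ne'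
      rw [h.curvature]
      field_simp
  simp only [e] at key
  rw [h.integral_curvature, h.length_eq ht] at key
  rw [le_div_iff₀ (by positivity)]
  linarith

theorem exists_curvature_eq_mean (h : IsAffineFlow u κ κb) (t : ℝ) :
    ∃ θ ∈ Set.Icc 0 (2 * π), κ θ t = κb t := by
  have ck := h.smooth_curvature.continuous_fst t
  have cg := (h.smooth_inv_pow 2).continuous_fst t
  have hd := hasDerivAt_integral_right
    (f := fun θ => (κ θ t - κb t) * (u θ t ^ 2)⁻¹) (by fun_prop) 0
  obtain ⟨θ, hθ, h0⟩ := exists_hasDerivAt_eq_zero (a := 0) (b := 2 * π) (by positivity)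
    (fun x _ => (hd x).continuousAt.continuousWithinAt)
    (by rw [h.integral_deviation, intervalIntegral.integral_same]) (fun x _ => hd x)
  refine ⟨θ, Set.Ioo_subset_Icc_self hθ, ?_⟩
  have := (mul_eq_zero.1 h0).resolve_right (h.inv_sq_pos θ t).ne'
  linarith

/-- The curvature deviation is controlled pointwise by its variance and Dirichlet energy. -/
theorem sq_deviation_le (h : IsAffineFlow u κ κb) (θ t : ℝ) :
    (κ θ t - κb t) ^ 2 ≤ (∫ θ in (0:ℝ)..(2 * π), (κ θ t - κb t) ^ 2 * (u θ t ^ 2)⁻¹) +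
      ∫ θ in (0:ℝ)..(2 * π), u θ t ^ 2 * partialFst κ θ t ^ 2 := by
  have hk := h.smooth_curvature
  have ck := hk.continuous_fst t
  have ck' := hk.partialFst.continuous_fst t
  have cu := h.smooth.continuous_fst t
  have cg := (h.smooth_inv_pow 2).continuous_fst t
  have hper : Function.Periodic (fun θ => κ θ t) (2 * π) := fun θ => h.curvature_periodic θ t
  obtain ⟨y, hy, hyθ⟩ := hper.exists_mem_Ico₀ (by positivity : 0 < 2 * π) θ
  obtain ⟨x, hx, hx0⟩ := h.exists_curvature_eq_mean t
  rw [show κ θ t = κ y t from hyθ, ← intervalIntegral.integral_add]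
  · have hd : ∀ z, HasDerivAt (fun z => (κ z t - κb t) ^ 2)
        (2 * (κ z t - κb t) * partialFst κ z t) z := fun z => by
      refine (((hk.hasDerivAt_fst z t).sub_const (κb t)).pow 2).congr_deriv ?_
      simp
    have hint : ∫ z in x..y, 2 * (κ z t - κb t) * partialFst κ z t = (κ y t - κb t) ^ 2 := by
      rw [intervalIntegral.integral_eq_sub_of_hasDerivAt (fun z _ => hd z)
        (Continuous.intervalIntegrable (by fun_prop) _ _), hx0]
      ring
    rw [← hint]
    have hle : ∀ z, |2 * (κ z t - κb t) * partialFst κ z t| ≤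
        (κ z t - κb t) ^ 2 * (u z t ^ 2)⁻¹ + u z t ^ 2 * partialFst κ z t ^ 2 := fun z => by
      have hu := (h.pos z t).ne'
      have e : 2 * (κ z t - κb t) * partialFst κ z t =
        2 * ((κ z t - κb t) * (u z t)⁻¹) * (u z t * partialFst κ z t) := by field_simp
      rw [e, ← inv_pow, ← mul_pow, ← mul_pow, abs_le]
      constructor
      · linarith [two_mul_le_add_sq (-((κ z t - κb t) * (u z t)⁻¹)) (u z t * partialFst κ z t),
          neg_sq ((κ z t - κb t) * (u z t)⁻¹)]
      · exact two_mul_le_add_sq _ _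
    have hsub : Set.uIoc x y ⊆ Set.uIoc 0 (2 * π) := by
      rw [Set.uIoc_of_le (by positivity : (0:ℝ) ≤ 2 * π)]
      intro z hz
      rcases Set.mem_uIoc.1 hz with hz | hz
      · exact ⟨hx.1.trans_lt hz.1, hz.2.trans hy.2.le⟩
      · exact ⟨hy.1.trans_lt hz.1, hz.2.trans hx.2⟩
    have hnn : ∀ z, 0 ≤ (κ z t - κb t) ^ 2 * (u z t ^ 2)⁻¹ + u z t ^ 2 * partialFst κ z t ^ 2 :=
      fun z => (abs_nonneg _).trans (hle z)
    refine (Real.le_norm_self _).trans ((intervalIntegral.norm_integral_le_abs_of_norm_le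
      (Eventually.of_forall hle) (Continuous.intervalIntegrable (by fun_prop) _ _)).trans
      ((intervalIntegral.abs_integral_mono_interval hsub (Eventually.of_forall hnn)
        (Continuous.intervalIntegrable (by fun_prop) _ _)).trans_eq
        (abs_of_nonneg (intervalIntegral.integral_nonneg (by positivity) fun z _ => hnn z))))
  all_goals exact Continuous.intervalIntegrable (by fun_prop) _ _

theorem variance_nonneg (h : IsAffineFlow u κ κb) (t : ℝ) :
    0 ≤ ∫ θ in (0:ℝ)..(2 * π), (κ θ t - κb t) ^ 2 * (u θ t ^ 2)⁻¹ :=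
  intervalIntegral.integral_nonneg (by positivity)
    fun θ _ => mul_nonneg (sq_nonneg _) (h.inv_sq_pos θ t).le

theorem energy_nonneg (u κ : ℝ → ℝ → ℝ) (t : ℝ) :
    0 ≤ ∫ θ in (0:ℝ)..(2 * π), u θ t ^ 2 * partialFst κ θ t ^ 2 :=
  intervalIntegral.integral_nonneg (by positivity) fun θ _ => by positivity

theorem integral_cube_deviation_le (h : IsAffineFlow u κ κb) {t m : ℝ}
    (hm : ∀ θ, |κ θ t - κb t| ≤ m) :
    ∫ θ in (0:ℝ)..(2 * π), (κ θ t - κb t) ^ 3 * (u θ t ^ 2)⁻¹ ≤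
      m * ∫ θ in (0:ℝ)..(2 * π), (κ θ t - κb t) ^ 2 * (u θ t ^ 2)⁻¹ := by
  have ck := h.smooth_curvature.continuous_fst t
  have cg := (h.smooth_inv_pow 2).continuous_fst t
  rw [← intervalIntegral.integral_const_mul]
  refine intervalIntegral.integral_mono (by positivity)
    (Continuous.intervalIntegrable (by fun_prop) _ _)
    (Continuous.intervalIntegrable (by fun_prop) _ _) fun θ => ?_
  have h1 := (abs_le.1 (hm θ)).2
  have h2 : 0 ≤ (κ θ t - κb t) ^ 2 * (u θ t ^ 2)⁻¹ :=
    mul_nonneg (sq_nonneg _) (h.inv_sq_pos θ t).le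
  calc (κ θ t - κb t) ^ 3 * (u θ t ^ 2)⁻¹ =
      (κ θ t - κb t) * ((κ θ t - κb t) ^ 2 * (u θ t ^ 2)⁻¹) := by ring
    _ ≤ m * ((κ θ t - κb t) ^ 2 * (u θ t ^ 2)⁻¹) := mul_le_mul_of_nonneg_right h1 h2

theorem energy_deriv_le (h : IsAffineFlow u κ κb) {t m : ℝ} (hm : ∀ θ, |κ θ t - κb t| ≤ m) :
    (∫ θ in (0:ℝ)..(2 * π), ((9 / 2) * (κ θ t - κb t) + 2 * κb t) *
        (u θ t ^ 2 * partialFst κ θ t ^ 2)) -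
      (1 / 2) * (∫ θ in (0:ℝ)..(2 * π), u θ t ^ 2 *
        partialFst (fun θ t => u θ t ^ 2 * partialFst κ θ t) θ t ^ 2) ≤
      ((9 / 2) * m + 2 * κb t) *
        ∫ θ in (0:ℝ)..(2 * π), u θ t ^ 2 * partialFst κ θ t ^ 2 := by
  have ck := h.smooth_curvature.continuous_fst t
  have ck' := h.smooth_curvature.partialFst.continuous_fst t
  have cu := h.smooth.continuous_fst t
  have h1 : 0 ≤ ∫ θ in (0:ℝ)..(2 * π), u θ t ^ 2 *
      partialFst (fun θ t => u θ t ^ 2 * partialFst κ θ t) θ t ^ 2 :=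
    energy_nonneg u (fun θ t => u θ t ^ 2 * partialFst κ θ t) t
  have h2 : ∫ θ in (0:ℝ)..(2 * π), ((9 / 2) * (κ θ t - κb t) + 2 * κb t) *
        (u θ t ^ 2 * partialFst κ θ t ^ 2) ≤ ((9 / 2) * m + 2 * κb t) *
        ∫ θ in (0:ℝ)..(2 * π), u θ t ^ 2 * partialFst κ θ t ^ 2 := by
    rw [← intervalIntegral.integral_const_mul]
    refine intervalIntegral.integral_mono (by positivity)
      (Continuous.intervalIntegrable (by fun_prop) _ _)
      (Continuous.intervalIntegrable (by fun_prop) _ _) fun θ => ?_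
    have := (abs_le.1 (hm θ)).2
    exact mul_le_mul_of_nonneg_right (by linarith) (by positivity)
  linarith

/-- Along the flow, the variance and the Dirichlet energy of the curvature tend to zero. -/
theorem tendsto_variance_add_energy (h : IsAffineFlow u κ κb)
    (hcos : ∫ θ in (0:ℝ)..(2 * π), (u θ 0 ^ 3)⁻¹ * cos θ = 0)
    (hsin : ∫ θ in (0:ℝ)..(2 * π), (u θ 0 ^ 3)⁻¹ * sin θ = 0) :
    Tendsto (fun t => (∫ θ in (0:ℝ)..(2 * π), (κ θ t - κb t) ^ 2 * (u θ t ^ 2)⁻¹) +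
      ∫ θ in (0:ℝ)..(2 * π), u θ t ^ 2 * partialFst κ θ t ^ 2) atTop (𝓝 0) := by
  have hF0 := h.variance_nonneg
  have hG0 := energy_nonneg u κ
  have hw := fun t θ => h.sq_deviation_le θ t
  have hFd := fun t (ht : 0 ≤ t) => h.hasDerivAt_variance ht
  have hGd := fun t (ht : 0 ≤ t) => h.hasDerivAt_energy ht
  have hkd := fun t (ht : 0 ≤ t) => h.hasDerivAt_mean_curvature ht
  have hF3 := fun t m (hm : ∀ θ, |κ θ t - κb t| ≤ m) => h.integral_cube_deviation_le hm
  have hGl := fun t m (hm : ∀ θ, |κ θ t - κb t| ≤ m) => h.energy_deriv_le hm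
  set F := fun t => ∫ θ in (0:ℝ)..(2 * π), (κ θ t - κb t) ^ 2 * (u θ t ^ 2)⁻¹ with hF
  set G := fun t => ∫ θ in (0:ℝ)..(2 * π), u θ t ^ 2 * partialFst κ θ t ^ 2 with hG
  set F3 := fun t => ∫ θ in (0:ℝ)..(2 * π), (κ θ t - κb t) ^ 3 * (u θ t ^ 2)⁻¹ with hF3def
  set G' := fun t => (∫ θ in (0:ℝ)..(2 * π), ((9 / 2) * (κ θ t - κb t) + 2 * κb t) *
        (u θ t ^ 2 * partialFst κ θ t ^ 2)) -
      (1 / 2) * (∫ θ in (0:ℝ)..(2 * π), u θ t ^ 2 *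
        partialFst (fun θ t => u θ t ^ 2 * partialFst κ θ t) θ t ^ 2) with hG'
  change ∀ t, 0 ≤ F t at hF0
  change ∀ t, 0 ≤ G t at hG0
  change ∀ t θ, (κ θ t - κb t) ^ 2 ≤ F t + G t at hw
  change ∀ t, 0 ≤ t → HasDerivAt F (-(1 / 2) * G t + (3 / 2) * F3 t + 2 * κb t * F t) t at hFd
  change ∀ t, 0 ≤ t → HasDerivAt G (G' t) t at hGd
  change ∀ t, 0 ≤ t → HasDerivAt κb (F t / (4 * π)) t at hkd
  change ∀ t m, (∀ θ, |κ θ t - κb t| ≤ m) → F3 t ≤ m * F t at hF3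
  change ∀ t m, (∀ θ, |κ θ t - κb t| ≤ m) → G' t ≤ ((9 / 2) * m + 2 * κb t) * G t at hGl
  change Tendsto (fun t => F t + G t) atTop (𝓝 0)
  clear_value F G F3 G'
  have hπ := pi_pos
  obtain ⟨K, hK0, hK⟩ : ∃ K, 0 ≤ K ∧ ∀ t, 0 ≤ t → κb t ≤ K :=
    ⟨64 / (2 * π) ^ 2, by positivity, fun t ht => h.mean_curvature_le hcos hsin ht⟩
  have hFK : ∀ t, 0 ≤ t → 2 * κb t * F t ≤ 2 * K * F t := fun t ht =>
    mul_le_mul_of_nonneg_right (by linarith [hK t ht]) (hF0 t)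
  have hPd : ∀ t, 0 ≤ t → HasDerivAt (fun t => 4 * π * κb t) (F t) t := fun t ht =>
    ((hkd t ht).const_mul (4 * π)).congr_deriv (by field_simp)
  have hPK : ∀ t, 0 ≤ t → 4 * π * κb t ≤ 4 * π * K := fun t ht =>
    mul_le_mul_of_nonneg_left (hK t ht) (by positivity)
  have hF' : ∀ t, 0 ≤ t → F t ≤ 1 / 3 →
      -(1 / 2) * G t + (3 / 2) * F3 t + 2 * κb t * F t ≤ -(1 / 4) * G t + (1 + 2 * K) * F t := by
    intro t ht hδ
    have h1 := hF3 t ((1 + F t + G t) / 2) fun θ => by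
      have := hw t θ
      nlinarith [sq_abs (κ θ t - κb t), sq_nonneg (|κ θ t - κb t| - 1)]
    have h2 := mul_le_mul_of_nonneg_left hδ (hF0 t)
    have h3 := mul_le_mul_of_nonneg_left hδ (hG0 t)
    have h4 := hFK t ht
    nlinarith
  have hFlim : Tendsto F atTop (𝓝 0) := by
    refine tendsto_zero_of_deriv_le (C := 1 + 2 * K) (δ := 1 / 3) (T := 0) (fun t _ => hF0 t)
      hFd hPd (fun t _ => le_rfl) hPK (by norm_num) (by positivity) fun t ht hδ => ?_
    linarith [hF' t ht hδ, hG0 t]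
  obtain ⟨T₀, hT₀⟩ := eventually_atTop.1 (hFlim.eventually_le_const (by norm_num : (0:ℝ) < 1 / 3))
  have hT : ∀ t, max T₀ 0 ≤ t → F t ≤ 1 / 3 ∧ 0 ≤ t := fun t ht =>
    ⟨hT₀ t (le_trans (le_max_left _ _) ht), le_trans (le_max_right _ _) ht⟩
  refine tendsto_zero_of_deriv_le (C := 9 / 2 + 2 * K) (δ := 1 / 3) (T := max T₀ 0)
    (fun t _ => add_nonneg (hF0 t) (hG0 t))
    (fun t ht => (hFd t (hT t ht).2).add (hGd t (hT t ht).2))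
    (fun t ht => ((hPd t (hT t ht).2).const_mul (5 + 8 * K)).sub
      ((hFd t (hT t ht).2).const_mul 4)) (fun t ht => ?_) (B := (5 + 8 * K) * (4 * π * K))
    (fun t ht => ?_) (by norm_num) (by positivity) fun t ht hδ => ?_
  · linarith [hF' t (hT t ht).2 (hT t ht).1]
  · have := mul_le_mul_of_nonneg_left (hPK t (hT t ht).2) (by positivity : 0 ≤ 5 + 8 * K)
    simp only [Pi.sub_apply]
    linarith [hF0 t]
  · have hm : ∀ θ, |κ θ t - κb t| ≤ 1 := fun θ =>
      (sq_le_one_iff_abs_le_one _).1 (by linarith [hw t θ])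
    have h1 := hF3 t 1 hm
    have h2 := hGl t 1 hm
    have h3 := hFK t (hT t ht).2
    have h4 : 2 * κb t * G t ≤ 2 * K * G t :=
      mul_le_mul_of_nonneg_right (by linarith [hK t (hT t ht).2]) (hG0 t)
    linarith [hF0 t, hG0 t]

/-- Uniform convergence of the affine curvature to its mean. -/
theorem tendsto_iSup_deviation (h : IsAffineFlow u κ κb)
    (hcos : ∫ θ in (0:ℝ)..(2 * π), (u θ 0 ^ 3)⁻¹ * cos θ = 0)
    (hsin : ∫ θ in (0:ℝ)..(2 * π), (u θ 0 ^ 3)⁻¹ * sin θ = 0) :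
    Tendsto (fun t => ⨆ θ : ℝ, |κ θ t - κb t|) atTop (𝓝 0) := by
  have hlim := (continuous_sqrt.tendsto 0).comp (h.tendsto_variance_add_energy hcos hsin)
  rw [sqrt_zero] at hlim
  exact squeeze_zero (fun t => Real.iSup_nonneg fun θ => abs_nonneg _)
    (fun t => ciSup_le fun θ => abs_le_sqrt (h.sq_deviation_le θ t)) hlim

end IsAffineFlow

/-- Uniform convergence of the affine curvature to its mean along the
normalized affine flow on S¹: `sup_θ |κ(θ,t) − κ̄(t)| → 0` as `t → ∞`. -/
theorem affine_flow_curvature_uniform_convergence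
    (u : ℝ → ℝ → ℝ)
    (hu : ContDiff ℝ (⊤ : ℕ∞) (fun p : ℝ × ℝ => u p.1 p.2))
    (huper : ∀ θ t, u (θ + 2 * π) t = u θ t)
    (hupos : ∀ θ t, 0 < u θ t)
    (kappa : ℝ → ℝ → ℝ)
    (hkappa : ∀ θ t, kappa θ t = (u θ t) ^ 3 * (deriv (deriv (fun x => u x t)) θ + u θ t))
    (kbar : ℝ → ℝ)
    (hkbar : ∀ t, kbar t =
      (∫ θ in (0:ℝ)..(2 * π), kappa θ t * ((u θ t) ^ 2)⁻¹) /
        ∫ θ in (0:ℝ)..(2 * π), ((u θ t) ^ 2)⁻¹)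
    (hflow : ∀ θ t, 0 ≤ t →
      deriv (fun s => u θ s) t = (1 / 4) * (kappa θ t - kbar t) * u θ t)
    (hnorm : ∫ θ in (0:ℝ)..(2 * π), ((u θ 0) ^ 2)⁻¹ = 2 * π)
    (horth0c : ∫ θ in (0:ℝ)..(2 * π), ((u θ 0) ^ 3)⁻¹ * Real.cos θ = 0)
    (horth0s : ∫ θ in (0:ℝ)..(2 * π), ((u θ 0) ^ 3)⁻¹ * Real.sin θ = 0) :
    Tendsto (fun t => ⨆ θ : ℝ, |kappa θ t - kbar t|) atTop (nhds 0) := by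
  have h : IsAffineFlow u kappa kbar :=
    ⟨hu, huper, hupos, hkappa, hkbar, hflow, hnorm⟩
  exact h.tendsto_iSup_deviation horth0c horth0s
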